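/- Let Φ={φ_i}_{i∈Λ} be an analytic IFS on I=[0,1] with 0<|φ_i'(x)|<1 for all i∈Λ and x∈I, whose maps have no common fixed point, let p be a positive probability vector and μ the associated exact dimensional self-conformal measure. For each 0<ε<1 and m≥1 there exists L(ε)≥1 such that for each l≥L(ε) there exists N(ε,m,l)≥1 such that for all n≥N(ε,m,l) the following holds: let ψ:I→ℝ be C¹ with ε ≤ |ψ'(x)| ≤ ε^{-1} for all x∈I and set θ:=ψμ. Then (λ_n×θ)(E) > 1−ε, where λ_n is the uniform measure on {1,…,n} and E is the set of pairs (i,x) such that ℙ_{i≤j≤i+m}{ |(1/l)H((θ_{x,i})_{y,j}, D_{j+l}) − dim μ| < ε } > 1−ε, the probability being over j uniform in {i,…,i+m} and y distributed according to θ_{x,i}. -/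

import Mathlib

open MeasureTheory Filter Set Metric Topology

noncomputable section

/-- The unit interval `I = [0,1]`. -/
def unitI : Set ℝ := Set.Icc 0 1

/-- For a word `u = i₁…iₙ`, `compWord φ u = φ_{i₁} ∘ … ∘ φ_{iₙ}`. -/
def compWord {Λ : Type*} (φ : Λ → ℝ → ℝ) : List Λ → ℝ → ℝ
  | [] => id
  | i :: u => φ i ∘ compWord φ u

/-- `μ` is exact dimensional with dimension `d`. -/
def ExactDimWith (μ : Measure ℝ) (d : ℝ) : Prop :=
  ∀ᵐ x ∂μ, Tendsto (fun δ : ℝ =>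
      Real.log (μ (Metric.closedBall x δ)).toReal / Real.log δ)
    (nhdsWithin 0 (Set.Ioi 0)) (nhds d)

/-- The level-`n` dyadic interval `[m/2^n, (m+1)/2^n)`. -/
def dyadIco (n : ℕ) (m : ℤ) : Set ℝ :=
  Set.Ico ((m : ℝ) / 2 ^ n) (((m : ℝ) + 1) / 2 ^ n)

/-- Entropy of a measure on `ℝ` with respect to the level-`n` dyadic partition
(logarithms in base 2). -/
def ent1 (n : ℕ) (θ : Measure ℝ) : ℝ :=
  -∑' m : ℤ, (θ (dyadIco n m)).toReal * Real.logb 2 (θ (dyadIco n m)).toReal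

/-- The level-`n` dyadic cell containing `x`. -/
def dcell (n : ℕ) (x : ℝ) : Set ℝ := dyadIco n ⌊x * 2 ^ n⌋

/-- The level-`n` component `θ_{x,n}`: `θ` conditioned on the dyadic cell of `x`. -/
def dcomp (θ : Measure ℝ) (x : ℝ) (n : ℕ) : Measure ℝ :=
  (θ (dcell n x))⁻¹ • θ.restrict (dcell n x)

/-! ### Finite entropy inequalities -/

theorem negMulLog_sum_le {ι : Type*} (s : Finset ι) (w : ι → ℝ) (hw : ∀ i ∈ s, 0 ≤ w i) :
    Real.negMulLog (∑ i ∈ s, w i) ≤ ∑ i ∈ s, Real.negMulLog (w i) := by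
  have h : ∀ i ∈ s, w i * Real.log (w i) ≤ w i * Real.log (∑ i ∈ s, w i) := by
    intro i hi
    rcases (hw i hi).eq_or_lt with h0 | h0
    · simp [← h0]
    · exact mul_le_mul_of_nonneg_left
        (Real.log_le_log h0 (Finset.single_le_sum (f := w) hw hi)) h0.le
  have := Finset.sum_le_sum h
  rw [← Finset.sum_mul] at this
  simp only [Real.negMulLog, neg_mul, Finset.sum_neg_distrib]
  linarith

theorem sum_negMulLog_le {ι : Type*} (s : Finset ι) (w : ι → ℝ) (hw : ∀ i ∈ s, 0 ≤ w i)
    (N : ℝ) (hN : ((s.filter fun i => w i ≠ 0).card : ℝ) ≤ N) :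
    ∑ i ∈ s, Real.negMulLog (w i) ≤
      Real.negMulLog (∑ i ∈ s, w i) + (∑ i ∈ s, w i) * Real.log N := by
  classical
  set t := s.filter fun i => w i ≠ 0 with ht
  have hsum : ∀ f : ℝ → ℝ, f 0 = 0 → ∑ i ∈ s, f (w i) = ∑ i ∈ t, f (w i) := by
    intro f hf
    symm
    apply Finset.sum_subset (Finset.filter_subset _ _)
    intro i hi hit
    have : w i = 0 := by
      by_contra h
      exact hit (Finset.mem_filter.2 ⟨hi, h⟩)
    simp [this, hf]
  rw [hsum Real.negMulLog (by simp), hsum (fun x => x) rfl]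
  have hpos : ∀ i ∈ t, 0 < w i := fun i hi =>
    lt_of_le_of_ne (hw i (Finset.mem_filter.1 hi).1) (Ne.symm (Finset.mem_filter.1 hi).2)
  rcases t.eq_empty_or_nonempty with he | hne
  · simp [he]
  set W := ∑ i ∈ t, w i with hW
  have hWpos : 0 < W := Finset.sum_pos hpos hne
  have hNpos : 0 < N := lt_of_lt_of_le (by exact_mod_cast hne.card_pos) hN
  have key : ∀ i ∈ t, Real.negMulLog (w i) ≤
      w i * (Real.log N - Real.log W) + (W / N - w i) := by
    intro i hi
    have h0 := hpos i hi
    have h1 := Real.log_le_sub_one_of_pos (show 0 < W / (N * w i) by positivity)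
    rw [Real.log_div hWpos.ne' (by positivity), Real.log_mul hNpos.ne' h0.ne'] at h1
    have h2 := mul_le_mul_of_nonneg_left h1 h0.le
    have h3 : w i * (W / (N * w i) - 1) = W / N - w i := by field_simp
    rw [h3] at h2
    simp only [Real.negMulLog]
    linarith
  have h := Finset.sum_le_sum key
  rw [Finset.sum_add_distrib, ← Finset.sum_mul, Finset.sum_sub_distrib, ← hW,
    Finset.sum_const, nsmul_eq_mul] at h
  have h4 : (t.card : ℝ) * (W / N) ≤ W := by
    rw [mul_div_assoc', div_le_iff₀ hNpos]
    nlinarith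
  simp only [Real.negMulLog] at h ⊢
  linarith

theorem sum_negMulLog_le_of_row_card {ι κ : Type*} (s : Finset ι) (t : Finset κ) (w : ι → κ → ℝ)
    (hw : ∀ i ∈ s, ∀ j ∈ t, 0 ≤ w i j) (N : ℝ)
    (hN : ∀ i ∈ s, ((t.filter fun j => w i j ≠ 0).card : ℝ) ≤ N) :
    ∑ j ∈ t, Real.negMulLog (∑ i ∈ s, w i j) ≤
      ∑ i ∈ s, Real.negMulLog (∑ j ∈ t, w i j) + (∑ i ∈ s, ∑ j ∈ t, w i j) * Real.log N := by
  calc ∑ j ∈ t, Real.negMulLog (∑ i ∈ s, w i j)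
      ≤ ∑ j ∈ t, ∑ i ∈ s, Real.negMulLog (w i j) :=
        Finset.sum_le_sum fun j hj => negMulLog_sum_le s _ fun i hi => hw i hi j hj
    _ = ∑ i ∈ s, ∑ j ∈ t, Real.negMulLog (w i j) := Finset.sum_comm
    _ ≤ ∑ i ∈ s, (Real.negMulLog (∑ j ∈ t, w i j) + (∑ j ∈ t, w i j) * Real.log N) :=
        Finset.sum_le_sum fun i hi => sum_negMulLog_le t _ (hw i hi) N (hN i hi)
    _ = _ := by rw [Finset.sum_add_distrib, Finset.sum_mul]

theorem log_sum_inequality {ι : Type*} (s : Finset ι) (x V : ι → ℝ) (hx : ∀ i ∈ s, 0 ≤ x i)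
    (hxV : ∀ i ∈ s, x i ≤ V i) :
    ∑ i ∈ s, (x i * Real.log (V i) - x i * Real.log (x i)) ≤
      (∑ i ∈ s, x i) * Real.log (∑ i ∈ s, V i) - (∑ i ∈ s, x i) * Real.log (∑ i ∈ s, x i) := by
  set X := ∑ i ∈ s, x i with hX
  set W := ∑ i ∈ s, V i with hW
  rcases (Finset.sum_nonneg hx).eq_or_lt with h0 | hXpos
  · have : ∀ i ∈ s, x i = 0 := (Finset.sum_eq_zero_iff_of_nonneg hx).1 h0.symm
    rw [hX, ← h0, Finset.sum_eq_zero fun i hi => by simp [this i hi]]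
    simp
  rw [← hX] at hXpos
  have hWpos : 0 < W := hXpos.trans_le (Finset.sum_le_sum hxV)
  have key : ∀ i ∈ s, x i * Real.log (V i) - x i * Real.log (x i) ≤
      x i * (Real.log W - Real.log X) + (V i * X / W - x i) := by
    intro i hi
    rcases (hx i hi).eq_or_lt with h0 | h0
    · have := h0.trans_le (hxV i hi)
      rw [← h0]
      simp only [zero_mul, sub_zero, zero_add]
      positivity
    have hV : 0 < V i := h0.trans_le (hxV i hi)
    have h1 := Real.log_le_sub_one_of_pos (show 0 < (V i * X) / (x i * W) by positivity)
    rw [Real.log_div (by positivity) (by positivity), Real.log_mul hV.ne' hXpos.ne',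
      Real.log_mul h0.ne' hWpos.ne'] at h1
    have h2 := mul_le_mul_of_nonneg_left h1 h0.le
    have h3 : x i * ((V i * X) / (x i * W) - 1) = V i * X / W - x i := by field_simp
    rw [h3] at h2
    linarith
  have h := Finset.sum_le_sum key
  rw [Finset.sum_add_distrib, ← Finset.sum_mul, Finset.sum_sub_distrib (f := fun i => V i * X / W),
    ← hX, ← Finset.sum_div,
    ← Finset.sum_mul, ← hW, mul_div_assoc, mul_comm W, div_mul_cancel₀ _ hWpos.ne'] at h
  linarith

theorem negMulLog_le_one {x : ℝ} (hx : 0 ≤ x) : Real.negMulLog x ≤ 1 := by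
  rcases hx.eq_or_lt with h | h
  · simp [← h]
  · have h1 := Real.log_le_sub_one_of_pos (inv_pos.2 h)
    rw [Real.log_inv] at h1
    have h2 := mul_le_mul_of_nonneg_left h1 hx
    rw [mul_sub, mul_inv_cancel₀ h.ne'] at h2
    simp only [Real.negMulLog]
    linarith

/-! ### Dyadic cells -/

theorem mem_dyadIco {n : ℕ} {m : ℤ} {x : ℝ} : x ∈ dyadIco n m ↔ ⌊x * 2 ^ n⌋ = m := by
  have h : (0 : ℝ) < 2 ^ n := by positivity
  rw [dyadIco, Set.mem_Ico, Int.floor_eq_iff, div_le_iff₀ h, lt_div_iff₀ h]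

theorem dyadIco_eq_preimage (n : ℕ) (m : ℤ) : dyadIco n m = (fun x : ℝ => ⌊x * 2 ^ n⌋) ⁻¹' {m} := by
  ext x
  simp [mem_dyadIco]

theorem measurable_floor_mul (n : ℕ) : Measurable fun x : ℝ => ⌊x * 2 ^ n⌋ :=
  Int.measurable_floor.comp (measurable_id.mul_const _)

theorem measurableSet_dyadIco (n : ℕ) (m : ℤ) : MeasurableSet (dyadIco n m) := measurableSet_Ico

theorem floor_mul_mem_Ico_iff (j l : ℕ) (q : ℤ) (x : ℝ) :
    ⌊x * 2 ^ (j + l)⌋ ∈ Finset.Ico (q * 2 ^ l) ((q + 1) * 2 ^ l) ↔ ⌊x * 2 ^ j⌋ = q := by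
  have h : (0 : ℝ) < 2 ^ l := by positivity
  rw [Finset.mem_Ico, Int.le_floor, Int.floor_lt, Int.floor_eq_iff]
  push_cast
  rw [pow_add, ← mul_assoc, mul_le_mul_iff_left₀ h, mul_lt_mul_iff_left₀ h]

theorem measureReal_eq_sum_fiber {X : Type*} [MeasurableSpace X] (ν : Measure X)
    [IsFiniteMeasure ν] {β : X → ℤ} (hβ : Measurable β)
    (S : Finset ℤ) (hS : ∀ᵐ x ∂ν, β x ∈ S) (A : Set X) :
    ν.real A = ∑ q ∈ S, ν.real (A ∩ β ⁻¹' {q}) := by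
  have h1 := sum_measureReal_preimage_singleton (μ := ν.restrict A) S (f := β)
    (fun y _ => hβ (measurableSet_singleton y))
  have h2 : (ν.restrict A).real (β ⁻¹' S) = ν.real A := by
    have : (ν.restrict A).real (β ⁻¹' S) = (ν.restrict A).real univ := by
      apply measureReal_congr
      filter_upwards [ae_restrict_of_ae hS] with x hx
      exact propext ⟨fun _ => trivial, fun _ => hx⟩
    rw [this]
    simp [Measure.real]
  rw [← h2, ← h1]
  refine Finset.sum_congr rfl fun q _ => ?_
  rw [measureReal_restrict_apply (hβ (measurableSet_singleton q)), inter_comm]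

theorem measureReal_dyadIco_eq_sum (ν : Measure ℝ) [IsFiniteMeasure ν] (j l : ℕ) (q : ℤ) :
    ν.real (dyadIco j q) =
      ∑ m ∈ Finset.Ico (q * 2 ^ l) ((q + 1) * 2 ^ l), ν.real (dyadIco (j + l) m) := by
  have h1 := sum_measureReal_preimage_singleton (μ := ν) (Finset.Ico (q * 2 ^ l) ((q + 1) * 2 ^ l))
    (f := fun x : ℝ => ⌊x * 2 ^ (j + l)⌋)
    (fun y _ => measurable_floor_mul _ (measurableSet_singleton y))
  simp only [← dyadIco_eq_preimage] at h1
  rw [h1]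
  congr 1
  ext x
  rw [mem_dyadIco, ← floor_mul_mem_Ico_iff j l q x, mem_preimage, Finset.mem_coe]

/-- Entropy (natural logarithm) of `ν` with respect to the level-`n` dyadic cells in `[A, B)`. -/
def cellEnt (A B : ℤ) (n : ℕ) (ν : Measure ℝ) : ℝ :=
  ∑ q ∈ Finset.Ico (A * 2 ^ n) (B * 2 ^ n), Real.negMulLog (ν.real (dyadIco n q))

/-- Contribution of the cell `dyadIco j q` to the conditional entropy of level `j + l`
given level `j` (natural logarithm). -/
def condEnt (j l : ℕ) (q : ℤ) (ν : Measure ℝ) : ℝ :=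
  ∑ m ∈ Finset.Ico (q * 2 ^ l) ((q + 1) * 2 ^ l), Real.negMulLog (ν.real (dyadIco (j + l) m)) -
    Real.negMulLog (ν.real (dyadIco j q))

theorem condEnt_nonneg (j l : ℕ) (q : ℤ) (ν : Measure ℝ) [IsFiniteMeasure ν] :
    0 ≤ condEnt j l q ν := by
  rw [condEnt, measureReal_dyadIco_eq_sum ν j l q, sub_nonneg]
  exact negMulLog_sum_le _ _ fun _ _ => measureReal_nonneg

theorem cellEnt_nonneg (A B : ℤ) (n : ℕ) (ν : Measure ℝ) [IsProbabilityMeasure ν] :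
    0 ≤ cellEnt A B n ν :=
  Finset.sum_nonneg fun _ _ => Real.negMulLog_nonneg measureReal_nonneg measureReal_le_one

theorem sum_Ico_children (A B : ℤ) (j l : ℕ) (f : ℤ → ℝ) :
    ∑ q ∈ Finset.Ico (A * 2 ^ j) (B * 2 ^ j),
      ∑ m ∈ Finset.Ico (q * 2 ^ l) ((q + 1) * 2 ^ l), f m =
    ∑ m ∈ Finset.Ico (A * 2 ^ (j + l)) (B * 2 ^ (j + l)), f m := by
  have h : (0 : ℤ) < 2 ^ l := by positivity
  have hmem : ∀ m : ℤ, m ∈ Finset.Ico (A * 2 ^ (j + l)) (B * 2 ^ (j + l)) ↔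
      m / 2 ^ l ∈ Finset.Ico (A * 2 ^ j) (B * 2 ^ j) := by
    intro m
    rw [Finset.mem_Ico, Finset.mem_Ico, Int.le_ediv_iff_mul_le h, Int.ediv_lt_iff_lt_mul h,
      pow_add, mul_assoc, mul_assoc]
  rw [← Finset.sum_fiberwise_of_maps_to (g := fun m : ℤ => m / 2 ^ l)
    (t := Finset.Ico (A * 2 ^ j) (B * 2 ^ j)) fun m hm => (hmem m).1 hm]
  refine Finset.sum_congr rfl fun q hq => Finset.sum_congr ?_ fun _ _ => rfl
  ext m
  rw [Finset.mem_filter, hmem, Finset.mem_Ico]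
  have h2 : m / 2 ^ l = q ↔ q * 2 ^ l ≤ m ∧ m < (q + 1) * 2 ^ l := by
    rw [← Int.le_ediv_iff_mul_le h, ← Int.ediv_lt_iff_lt_mul h]
    omega
  rw [h2]
  refine ⟨fun hm => ⟨?_, hm⟩, fun hm => hm.2⟩
  rw [h2.2 hm]
  exact hq

theorem sum_condEnt (A B : ℤ) (j l : ℕ) (ν : Measure ℝ) :
    ∑ q ∈ Finset.Ico (A * 2 ^ j) (B * 2 ^ j), condEnt j l q ν =
      cellEnt A B (j + l) ν - cellEnt A B j ν := by
  simp only [condEnt, Finset.sum_sub_distrib, cellEnt, sum_Ico_children]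

theorem cellEnt_mono (A B : ℤ) (ν : Measure ℝ) [IsFiniteMeasure ν] :
    Monotone fun n => cellEnt A B n ν := by
  refine monotone_nat_of_le_succ fun n => ?_
  have := sum_condEnt A B n 1 ν
  have h2 : 0 ≤ ∑ q ∈ Finset.Ico (A * 2 ^ n) (B * 2 ^ n), condEnt n 1 q ν :=
    Finset.sum_nonneg fun q _ => condEnt_nonneg n 1 q ν
  linarith

theorem sum_sub_shift_le (H : ℕ → ℝ) (hmono : Monotone H) (h0 : ∀ n, 0 ≤ H n) (l n : ℕ) :
    ∑ j ∈ Finset.Icc 1 n, (H (j + l) - H j) ≤ l * H (n + l) := by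
  have key : ∑ j ∈ Finset.Icc 1 n, (H (j + l) - H j) =
      ∑ t ∈ Finset.range l, (H (n + t + 1) - H (t + 1)) := by
    induction n with
    | zero => simp
    | succ n ih =>
      rw [Finset.sum_Icc_succ_top (by omega), ih]
      have h2 : ∑ t ∈ Finset.range l, (H (n + t + 1 + 1) - H (n + t + 1)) =
          H (n + 1 + l) - H (n + 1) := by
        have := Finset.sum_range_sub (fun t => H (n + t + 1)) l
        simp only [add_zero] at this
        rw [show n + 1 + l = n + l + 1 by ring, ← this]
        exact Finset.sum_congr rfl fun t _ => by rw [add_assoc n t 1]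
      rw [← h2, ← Finset.sum_add_distrib]
      refine Finset.sum_congr rfl fun t _ => ?_
      rw [show n + 1 + t + 1 = n + t + 1 + 1 by ring]
      ring
  rw [key]
  calc ∑ t ∈ Finset.range l, (H (n + t + 1) - H (t + 1))
      ≤ ∑ t ∈ Finset.range l, H (n + l) := by
        refine Finset.sum_le_sum fun t ht => ?_
        have := hmono (show n + t + 1 ≤ n + l by have := Finset.mem_range.1 ht; omega)
        linarith [h0 (t + 1)]
    _ = l * H (n + l) := by simp

/-- Points within `2^{-(i+k)}` of the grid `2^{-i}ℤ`. -/
def gridNhd (i k : ℕ) : Set ℝ := ⋃ z : ℤ, closedBall ((z : ℝ) / 2 ^ i) ((2 ^ (i + k))⁻¹)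

theorem measurableSet_gridNhd (i k : ℕ) : MeasurableSet (gridNhd i k) :=
  MeasurableSet.iUnion fun _ => isClosed_closedBall.measurableSet

/-- Superadditivity of the conditional entropy. -/
theorem condEnt_superadditive {Λ : Type*} [Fintype Λ] (p : Λ → ℝ) (hp : ∀ i, 0 ≤ p i)
    (ν : Measure ℝ) [IsFiniteMeasure ν] (κ : Λ → Measure ℝ) [∀ a, IsFiniteMeasure (κ a)]
    (h : ∀ A, MeasurableSet A → ν.real A = ∑ a, p a * (κ a).real A) (j l : ℕ) (q : ℤ) :
    ∑ a, p a * condEnt j l q (κ a) ≤ condEnt j l q ν := by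
  have expand : ∀ (ρ : Measure ℝ) [IsFiniteMeasure ρ], condEnt j l q ρ =
      ∑ m ∈ Finset.Ico (q * 2 ^ l) ((q + 1) * 2 ^ l),
        (ρ.real (dyadIco (j + l) m) * Real.log (ρ.real (dyadIco j q)) -
          ρ.real (dyadIco (j + l) m) * Real.log (ρ.real (dyadIco (j + l) m))) := by
    intro ρ _
    rw [Finset.sum_sub_distrib, ← Finset.sum_mul, ← measureReal_dyadIco_eq_sum, condEnt]
    simp only [Real.negMulLog, neg_mul, Finset.sum_neg_distrib]
    ring
  rw [expand ν]
  simp only [expand, Finset.mul_sum]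
  rw [Finset.sum_comm]
  refine Finset.sum_le_sum fun m hm => ?_
  rw [h _ (measurableSet_dyadIco _ _), h _ (measurableSet_dyadIco _ _)]
  have hle : ∀ a, (κ a).real (dyadIco (j + l) m) ≤ (κ a).real (dyadIco j q) := by
    intro a
    rw [measureReal_dyadIco_eq_sum (κ a) j l q]
    exact Finset.single_le_sum (f := fun m => (κ a).real (dyadIco (j + l) m))
      (fun _ _ => measureReal_nonneg) hm
  refine le_trans (Finset.sum_le_sum fun a _ => ?_) (log_sum_inequality Finset.univ
    (fun a => p a * (κ a).real (dyadIco (j + l) m)) (fun a => p a * (κ a).real (dyadIco j q))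
    (fun a _ => mul_nonneg (hp a) measureReal_nonneg)
    (fun a _ => mul_le_mul_of_nonneg_left (hle a) (hp a)))
  rcases (hp a).eq_or_lt with h0 | h0
  · simp [← h0]
  rcases (measureReal_nonneg (μ := κ a) (s := dyadIco (j + l) m)).eq_or_lt with h1 | h1
  · simp [← h1]
  have h2 := h1.trans_le (hle a)
  rw [Real.log_mul h0.ne' h2.ne', Real.log_mul h0.ne' h1.ne']
  apply le_of_eq
  ring

/-- If the fibres of `α` meet boundedly many fibres of `β`, the entropy of `β` exceeds that of `α`
by a bounded amount. -/
theorem label_entropy_le {X : Type*} [MeasurableSpace X] (μ : Measure X) [IsProbabilityMeasure μ]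
    (I : Set X) (hI : ∀ᵐ x ∂μ, x ∈ I)
    {α β : X → ℤ} (hα : Measurable α) (hβ : Measurable β) (S T : Finset ℤ)
    (hS : ∀ᵐ x ∂μ, α x ∈ S) (hT : ∀ᵐ x ∂μ, β x ∈ T) (N : ℕ)
    (h : ∀ x ∈ I, ∀ y ∈ I, α x = α y → |β x - β y| ≤ N) :
    ∑ j ∈ T, Real.negMulLog (μ.real (β ⁻¹' {j})) ≤
      ∑ i ∈ S, Real.negMulLog (μ.real (α ⁻¹' {i})) + Real.log (2 * N + 1) := by
  have hrow : ∀ i, μ.real (α ⁻¹' {i}) = ∑ j ∈ T, μ.real (α ⁻¹' {i} ∩ β ⁻¹' {j}) :=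
    fun i => measureReal_eq_sum_fiber μ hβ T hT _
  have hcol : ∀ j, μ.real (β ⁻¹' {j}) = ∑ i ∈ S, μ.real (α ⁻¹' {i} ∩ β ⁻¹' {j}) := by
    intro j
    rw [measureReal_eq_sum_fiber μ hα S hS]
    simp only [inter_comm]
  have htot : ∑ i ∈ S, ∑ j ∈ T, μ.real (α ⁻¹' {i} ∩ β ⁻¹' {j}) = 1 := by
    simp only [← hrow]
    have := measureReal_eq_sum_fiber μ hα S hS univ
    simpa using this.symm
  have := sum_negMulLog_le_of_row_card S T (fun i j => μ.real (α ⁻¹' {i} ∩ β ⁻¹' {j}))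
    (fun _ _ _ _ => measureReal_nonneg) (2 * N + 1) (by
      intro i _
      rcases (T.filter fun j => μ.real (α ⁻¹' {i} ∩ β ⁻¹' {j}) ≠ 0).eq_empty_or_nonempty with
        he | ⟨j₀, hj₀⟩
      · rw [he]
        simp
        positivity
      have hex : ∀ j, μ.real (α ⁻¹' {i} ∩ β ⁻¹' {j}) ≠ 0 → ∃ x ∈ I, α x = i ∧ β x = j := by
        intro j hj
        by_contra hcon
        push Not at hcon
        apply hj
        have : μ (α ⁻¹' {i} ∩ β ⁻¹' {j}) = 0 := by
          rw [measure_eq_zero_iff_ae_notMem]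
          filter_upwards [hI] with x hx hx2
          exact hcon x hx hx2.1 hx2.2
        simp [Measure.real, this]
      obtain ⟨x₀, hx₀, hax₀, hbx₀⟩ := hex j₀ (Finset.mem_filter.1 hj₀).2
      have hsub : (T.filter fun j => μ.real (α ⁻¹' {i} ∩ β ⁻¹' {j}) ≠ 0) ⊆
          Finset.Icc (j₀ - N) (j₀ + N) := by
        intro j hj
        obtain ⟨x, hx, hax, hbx⟩ := hex j (Finset.mem_filter.1 hj).2
        have := h x hx x₀ hx₀ (hax.trans hax₀.symm)
        rw [hbx, hbx₀, abs_le] at this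
        rw [Finset.mem_Icc]
        omega
      have hc := Finset.card_le_card hsub
      rw [Int.card_Icc] at hc
      have : (T.filter fun j => μ.real (α ⁻¹' {i} ∩ β ⁻¹' {j}) ≠ 0).card ≤ 2 * N + 1 := by omega
      exact_mod_cast this)
  rw [htot, one_mul] at this
  simp only [← hrow, ← hcol] at this
  exact this

theorem floor_mul_mem_Ico {A B : ℤ} {x : ℝ} (h : x ∈ Ico (A : ℝ) B) (n : ℕ) :
    ⌊x * 2 ^ n⌋ ∈ Finset.Ico (A * 2 ^ n) (B * 2 ^ n) := by
  have h2 : (0 : ℝ) < 2 ^ n := by positivity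
  rw [Finset.mem_Ico, Int.le_floor, Int.floor_lt]
  push_cast
  exact ⟨mul_le_mul_of_nonneg_right h.1 h2.le, mul_lt_mul_of_pos_right h.2 h2⟩

/-! ### Exact dimension and entropy -/

theorem measurable_measureReal_closedBall (μ : Measure ℝ) [IsFiniteMeasure μ] (r : ℝ) :
    Measurable fun x => μ.real (closedBall x r) := by
  have hm : MeasurableSet {z : ℝ × ℝ | dist z.2 z.1 ≤ r} :=
    (isClosed_le (continuous_snd.dist continuous_fst) continuous_const).measurableSet
  exact (measurable_measure_prodMk_left (ν := μ) hm).ennreal_toReal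

theorem tendsto_two_pow_inv : Tendsto (fun n : ℕ => ((2 : ℝ) ^ n)⁻¹) atTop (𝓝[>] 0) := by
  rw [tendsto_nhdsWithin_iff]
  refine ⟨?_, Eventually.of_forall fun n => by simp⟩
  simp only [← inv_pow]
  exact tendsto_pow_atTop_nhds_zero_of_lt_one (by norm_num) (by norm_num)

theorem ExactDimWith.eventually_measure_le {μ : Measure ℝ} [IsProbabilityMeasure μ] {d : ℝ}
    (h : ExactDimWith μ d) {δ : ℝ} (hδ : 0 < δ) :
    ∀ᶠ n : ℕ in atTop, μ.real {x | δ ≤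
      |Real.log (μ.real (closedBall x (2 ^ n)⁻¹)) / Real.log ((2 ^ n)⁻¹) - d|} ≤ δ := by
  have h1 : TendstoInMeasure μ (fun (n : ℕ) x =>
      Real.log (μ.real (closedBall x (2 ^ n)⁻¹)) / Real.log ((2 ^ n)⁻¹)) atTop (fun _ => d) := by
    apply tendstoInMeasure_of_tendsto_ae
    · intro n
      exact ((Real.measurable_log.comp
        (measurable_measureReal_closedBall μ _)).div_const _).aestronglyMeasurable
    · filter_upwards [h] with x hx
      exact hx.comp tendsto_two_pow_inv
  have h2 := (tendstoInMeasure_iff_dist.1 h1) δ hδ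
  have h3 : ∀ᶠ n : ℕ in atTop, μ {x | δ ≤
      dist (Real.log (μ.real (closedBall x (2 ^ n)⁻¹)) / Real.log ((2 ^ n)⁻¹)) d} <
        ENNReal.ofReal δ := h2.eventually_lt_const (by simpa using hδ)
  filter_upwards [h3] with n hn
  simp only [Real.dist_eq] at hn
  rw [Measure.real]
  exact (ENNReal.toReal_le_of_le_ofReal hδ.le hn.le)

theorem ExactDimWith.nonneg {μ : Measure ℝ} [IsProbabilityMeasure μ] {d : ℝ}
    (h : ExactDimWith μ d) : 0 ≤ d := by
  obtain ⟨x, hx⟩ := h.exists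
  refine ge_of_tendsto (hx.comp tendsto_two_pow_inv) (Eventually.of_forall fun n => ?_)
  apply div_nonneg_of_nonpos
  · exact Real.log_nonpos measureReal_nonneg measureReal_le_one
  · rw [Real.log_inv, neg_nonpos]
    exact Real.log_nonneg (one_le_pow₀ (by norm_num))

theorem ExactDimWith.measure_singleton {μ : Measure ℝ} [IsProbabilityMeasure μ] {d : ℝ}
    (h : ExactDimWith μ d) (hd : 0 < d) (x : ℝ) : μ {x} = 0 := by
  by_contra hx
  have hx' : Tendsto (fun δ : ℝ => Real.log (μ.real (closedBall x δ)) / Real.log δ)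
      (𝓝[>] 0) (𝓝 d) := by
    by_contra hcon
    exact hx (measure_mono_null (singleton_subset_iff.2 hcon) (ae_iff.1 h))
  have h1 := hx'.comp tendsto_two_pow_inv
  have hpos : 0 < μ.real {x} := ENNReal.toReal_pos hx (measure_ne_top _ _)
  have h2 : Tendsto (fun n : ℕ => (-Real.log (μ.real {x}) / Real.log 2) * (n : ℝ)⁻¹) atTop
      (𝓝 ((-Real.log (μ.real {x}) / Real.log 2) * 0)) :=
    tendsto_inv_atTop_nhds_zero_nat.const_mul _
  rw [mul_zero] at h2
  refine hd.not_ge (le_of_tendsto_of_tendsto h1 h2 ?_)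
  filter_upwards [eventually_gt_atTop 0] with n hn
  have hlog : 0 < Real.log 2 := Real.log_pos (by norm_num)
  have hn' : (0 : ℝ) < n := by exact_mod_cast hn
  have hle : Real.log (μ.real {x}) ≤ Real.log (μ.real (closedBall x (2 ^ n)⁻¹)) :=
    Real.log_le_log hpos (measureReal_mono (singleton_subset_iff.2
      (mem_closedBall_self (by positivity))))
  simp only [Function.comp]
  rw [Real.log_inv, Real.log_pow, div_neg, ← neg_div, ← div_eq_mul_inv, div_div, mul_comm]
  exact div_le_div_of_nonneg_right (by linarith) (by positivity)

theorem dyadIco_subset_closedBall {n : ℕ} {q : ℤ} {x : ℝ} (hx : x ∈ dyadIco n q) :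
    dyadIco n q ⊆ closedBall x (2 ^ n)⁻¹ := by
  intro y hy
  have h : ((q : ℝ) + 1) / 2 ^ n = q / 2 ^ n + (2 ^ n)⁻¹ := by field_simp
  rw [dyadIco, mem_Ico, h] at hx hy
  rw [mem_closedBall, Real.dist_eq, abs_le]
  constructor <;> linarith [hx.1, hx.2, hy.1, hy.2]

theorem closedBall_subset_dyadIco {n : ℕ} {q : ℤ} {x : ℝ} (hx : x ∈ dyadIco n q) :
    closedBall x (2 ^ n)⁻¹ ⊆ dyadIco n (q - 1) ∪ (dyadIco n q ∪ dyadIco n (q + 1)) := by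
  intro y hy
  rw [mem_closedBall, Real.dist_eq, abs_le] at hy
  have h0 : (0 : ℝ) < 2 ^ n := by positivity
  rw [mem_dyadIco, Int.floor_eq_iff] at hx
  simp only [mem_union, mem_dyadIco]
  have h1 : y * 2 ^ n ≤ x * 2 ^ n + 1 := by
    have := mul_le_mul_of_nonneg_right (show y ≤ x + (2 ^ n)⁻¹ by linarith) h0.le
    rwa [add_mul, inv_mul_cancel₀ h0.ne'] at this
  have h2 : x * 2 ^ n - 1 ≤ y * 2 ^ n := by
    have := mul_le_mul_of_nonneg_right (show x - (2 ^ n)⁻¹ ≤ y by linarith) h0.le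
    rwa [sub_mul, inv_mul_cancel₀ h0.ne'] at this
  have h3 : q - 1 ≤ ⌊y * 2 ^ n⌋ := by
    rw [Int.le_floor]; push_cast; linarith
  have h4 : ⌊y * 2 ^ n⌋ < q + 2 := by
    rw [Int.floor_lt]; push_cast; linarith
  omega

theorem sum_measureReal_dyadIco_le_one (μ : Measure ℝ) [IsProbabilityMeasure μ] (n : ℕ)
    (S : Finset ℤ) : ∑ q ∈ S, μ.real (dyadIco n q) ≤ 1 := by
  simp only [dyadIco_eq_preimage]
  rw [sum_measureReal_preimage_singleton S
    (fun y _ => measurable_floor_mul n (measurableSet_singleton y))]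
  exact measureReal_le_one

theorem ExactDimWith.le_cellEnt {μ : Measure ℝ} [IsProbabilityMeasure μ] {d : ℝ}
    (h : ExactDimWith μ d) {A B : ℤ} (hAB : ∀ᵐ x ∂μ, x ∈ Ico (A : ℝ) B) {δ : ℝ} (hδ : 0 < δ) :
    ∀ᶠ n : ℕ in atTop, n * ((d - δ) * Real.log 2) ≤ cellEnt A B n μ := by
  have hlog : 0 < Real.log 2 := Real.log_pos (by norm_num)
  have hd := h.nonneg
  rcases le_or_gt d δ with hdδ | hdδ
  · refine Eventually.of_forall fun n => le_trans ?_ (cellEnt_nonneg A B n μ)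
    exact mul_nonpos_of_nonneg_of_nonpos (Nat.cast_nonneg _)
      (mul_nonpos_of_nonpos_of_nonneg (by linarith) hlog.le)
  set η := δ / (1 + d) with hη
  have hη0 : 0 < η := by positivity
  have hη1 : η * (1 + d) = δ := by rw [hη]; field_simp
  have hηδ : η ≤ δ := by nlinarith
  filter_upwards [h.eventually_measure_le hη0] with n hn
  classical
  set bad := {x | η ≤ |Real.log (μ.real (closedBall x (2 ^ n)⁻¹)) / Real.log ((2 ^ n)⁻¹) - d|}
    with hbad
  set S := Finset.Ico (A * 2 ^ n) (B * 2 ^ n) with hSdef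
  have hS : ∀ᵐ x ∂μ, ⌊x * 2 ^ n⌋ ∈ S := hAB.mono fun x hx => floor_mul_mem_Ico hx n
  set c := n * ((d - η) * Real.log 2) with hc
  have hc0 : 0 ≤ c := mul_nonneg (Nat.cast_nonneg _) (mul_nonneg (by linarith) hlog.le)
  have hterm : ∀ q ∈ S, c * (μ.real (dyadIco n q) - μ.real (bad ∩ dyadIco n q)) ≤
      Real.negMulLog (μ.real (dyadIco n q)) := by
    intro q _
    have hnn : 0 ≤ Real.negMulLog (μ.real (dyadIco n q)) :=
      Real.negMulLog_nonneg measureReal_nonneg measureReal_le_one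
    by_cases hsub : dyadIco n q ⊆ bad
    · rw [inter_eq_self_of_subset_right hsub]
      simpa using hnn
    · obtain ⟨x, hxq, hxb⟩ := not_subset.1 hsub
      simp only [hbad, mem_ofPred_eq, not_le] at hxb
      rcases (measureReal_nonneg (μ := μ) (s := dyadIco n q)).eq_or_lt with h0 | h0
      · rw [← h0]
        simp only [zero_sub, mul_neg, Real.negMulLog_zero]
        exact neg_nonpos.2 (mul_nonneg hc0 measureReal_nonneg)
      have hlt : Real.log (μ.real (dyadIco n q)) ≤ Real.log (μ.real (closedBall x (2 ^ n)⁻¹)) :=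
        Real.log_le_log h0 (measureReal_mono (dyadIco_subset_closedBall hxq))
      have hc2 : Real.log (μ.real (closedBall x (2 ^ n)⁻¹)) ≤ -c := by
        rw [Real.log_inv, Real.log_pow] at hxb
        rcases Nat.eq_zero_or_pos n with hn0 | hn0
        · rw [hc, hn0]
          simpa using Real.log_nonpos measureReal_nonneg measureReal_le_one
        have hn1 : (0 : ℝ) < n := by exact_mod_cast hn0
        have h2 := (abs_lt.1 hxb).1
        have h3 : d - η < -Real.log (μ.real (closedBall x (2 ^ n)⁻¹)) / (n * Real.log 2) := by
          rw [neg_div, ← div_neg]; linarith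
        rw [lt_div_iff₀ (by positivity)] at h3
        rw [hc]
        linarith
      have h4 : c * (μ.real (dyadIco n q) - μ.real (bad ∩ dyadIco n q)) ≤
          c * μ.real (dyadIco n q) :=
        mul_le_mul_of_nonneg_left (sub_le_self _ measureReal_nonneg) hc0
      have h5 := mul_le_mul_of_nonneg_left (hlt.trans hc2) h0.le
      rw [Real.negMulLog]
      linarith
  have hsum := Finset.sum_le_sum hterm
  have e1 : ∑ q ∈ S, μ.real (dyadIco n q) = 1 := by
    have := measureReal_eq_sum_fiber μ (measurable_floor_mul n) S hS univ
    simp only [univ_inter, ← dyadIco_eq_preimage] at this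
    simpa using this.symm
  have e2 : ∑ q ∈ S, μ.real (bad ∩ dyadIco n q) = μ.real bad := by
    simp only [dyadIco_eq_preimage]
    exact (measureReal_eq_sum_fiber μ (measurable_floor_mul n) S hS bad).symm
  rw [← Finset.mul_sum, Finset.sum_sub_distrib, e1, e2] at hsum
  refine le_trans ?_ hsum
  have h6 : c * (1 - η) ≤ c * (1 - μ.real bad) := mul_le_mul_of_nonneg_left (by linarith) hc0
  refine le_trans ?_ h6
  have h7 : d - δ ≤ (d - η) * (1 - η) := by nlinarith
  calc n * ((d - δ) * Real.log 2) ≤ n * (((d - η) * (1 - η)) * Real.log 2) := by gcongr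
    _ = c * (1 - η) := by rw [hc]; ring

theorem ExactDimWith.cellEnt_le {μ : Measure ℝ} [IsProbabilityMeasure μ] {d : ℝ}
    (h : ExactDimWith μ d) {A B : ℤ} (hAB : ∀ᵐ x ∂μ, x ∈ Ico (A : ℝ) B) {δ : ℝ} (hδ : 0 < δ) :
    ∀ᶠ n : ℕ in atTop, cellEnt A B n μ ≤ n * ((d + δ) * Real.log 2) := by
  have hlog : 0 < Real.log 2 := Real.log_pos (by norm_num)
  have hd := h.nonneg
  set η := δ / 4 with hη
  have hη0 : 0 < η := by positivity
  have hlt : A < B := by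
    obtain ⟨x, hx⟩ := hAB.exists
    exact_mod_cast hx.1.trans_lt hx.2
  set R : ℝ := (B - A : ℝ) with hR
  have hR1 : 1 ≤ R := by
    have : (A : ℝ) + 1 ≤ B := by exact_mod_cast hlt
    linarith
  have hlarge : ∀ᶠ n : ℕ in atTop, 2 + Real.log 3 + Real.log R * η ≤ n * (2 * η * Real.log 2) :=
    (tendsto_natCast_atTop_atTop.atTop_mul_const (by positivity)).eventually_ge_atTop _
  filter_upwards [h.eventually_measure_le hη0, hlarge] with n hn hnl
  classical
  set bad := {x | η ≤ |Real.log (μ.real (closedBall x (2 ^ n)⁻¹)) / Real.log ((2 ^ n)⁻¹) - d|}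
    with hbad
  set S := Finset.Ico (A * 2 ^ n) (B * 2 ^ n) with hSdef
  have hS : ∀ᵐ x ∂μ, ⌊x * 2 ^ n⌋ ∈ S := hAB.mono fun x hx => floor_mul_mem_Ico hx n
  set w : ℤ → ℝ := fun q => μ.real (dyadIco n q) with hw
  have hw0 : ∀ q, 0 ≤ w q := fun q => measureReal_nonneg
  set G := S.filter fun q => ¬ dyadIco n q ⊆ bad with hG
  set Bd := S.filter fun q => dyadIco n q ⊆ bad with hBd
  have hsplit : cellEnt A B n μ =
      ∑ q ∈ Bd, Real.negMulLog (w q) + ∑ q ∈ G, Real.negMulLog (w q) :=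
    (Finset.sum_filter_add_sum_filter_not _ _ _).symm
  have hball : ∀ q ∈ G, w q ≠ 0 →
      Real.exp (-(n * ((d + η) * Real.log 2))) ≤ w (q - 1) + (w q + w (q + 1)) := by
    intro q hq hwq
    obtain ⟨x, hxq, hxb⟩ := not_subset.1 (Finset.mem_filter.1 hq).2
    simp only [hbad, mem_ofPred_eq, not_le] at hxb
    have hpos : 0 < μ.real (closedBall x (2 ^ n)⁻¹) :=
      (lt_of_le_of_ne (hw0 q) (Ne.symm hwq)).trans_le
        (measureReal_mono (dyadIco_subset_closedBall hxq))
    have h1 : Real.exp (-(n * ((d + η) * Real.log 2))) ≤ μ.real (closedBall x (2 ^ n)⁻¹) := by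
      rw [← Real.le_log_iff_exp_le hpos]
      rw [Real.log_inv, Real.log_pow] at hxb
      rcases Nat.eq_zero_or_pos n with hn0 | hn0
      · exfalso
        have h3 : 0 ≤ Real.log 3 := Real.log_nonneg (by norm_num)
        have h4 : 0 ≤ Real.log R * η := mul_nonneg (Real.log_nonneg hR1) hη0.le
        rw [hn0] at hnl
        norm_num at hnl
        linarith
      have hn1 : (0 : ℝ) < n := by exact_mod_cast hn0
      have h2 := (abs_lt.1 hxb).2
      have h3 : -Real.log (μ.real (closedBall x (2 ^ n)⁻¹)) / (n * Real.log 2) < d + η := by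
        rw [neg_div, ← div_neg]; linarith
      rw [div_lt_iff₀ (by positivity)] at h3
      linarith
    refine h1.trans ((measureReal_mono (closedBall_subset_dyadIco hxq)).trans ?_)
    refine (measureReal_union_le _ _).trans ?_
    have := measureReal_union_le (μ := μ) (dyadIco n q) (dyadIco n (q + 1))
    simp only [hw]
    linarith
  have hshift : ∀ c : ℤ, ∀ F : Finset ℤ, ∑ q ∈ F, w (q + c) ≤ 1 := by
    intro c F
    have := sum_measureReal_dyadIco_le_one μ n (F.map (addRightEmbedding c))
    rw [Finset.sum_map] at this
    simpa using this
  have hcard : ((G.filter fun q => w q ≠ 0).card : ℝ) ≤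
      3 * Real.exp (n * ((d + η) * Real.log 2)) := by
    have h1 : ((G.filter fun q => w q ≠ 0).card : ℝ) * Real.exp (-(n * ((d + η) * Real.log 2))) ≤
        3 := by
      rw [← nsmul_eq_mul, ← Finset.sum_const]
      calc _ ≤ ∑ q ∈ G.filter fun q => w q ≠ 0, (w (q - 1) + (w q + w (q + 1))) :=
            Finset.sum_le_sum fun q hq =>
              hball q (Finset.mem_filter.1 hq).1 (Finset.mem_filter.1 hq).2
        _ ≤ 3 := by
            rw [Finset.sum_add_distrib, Finset.sum_add_distrib]
            have a := hshift (-1) (G.filter fun q => w q ≠ 0)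
            have b := hshift 0 (G.filter fun q => w q ≠ 0)
            have c := hshift 1 (G.filter fun q => w q ≠ 0)
            simp only [add_zero, ← sub_eq_add_neg] at a b c
            linarith
    rw [Real.exp_neg, ← div_eq_mul_inv, div_le_iff₀ (Real.exp_pos _)] at h1
    exact h1
  have hgood := sum_negMulLog_le G w (fun q _ => hw0 q) _ hcard
  have hbadc : ((Bd.filter fun q => w q ≠ 0).card : ℝ) ≤ R * 2 ^ n := by
    have h1 : (Bd.filter fun q => w q ≠ 0).card ≤ S.card :=
      Finset.card_le_card ((Finset.filter_subset _ _).trans (Finset.filter_subset _ _))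
    have h2 : (S.card : ℝ) = R * 2 ^ n := by
      rw [hSdef, Int.card_Ico]
      have h3 : (0 : ℤ) ≤ B * 2 ^ n - A * 2 ^ n := by
        rw [← sub_mul]; exact mul_nonneg (by omega) (by positivity)
      have h4 : (((B * 2 ^ n - A * 2 ^ n).toNat : ℤ) : ℝ) = ((B * 2 ^ n - A * 2 ^ n : ℤ) : ℝ) := by
        rw [Int.toNat_of_nonneg h3]
      rw [Int.cast_natCast] at h4
      rw [h4, hR]
      push_cast
      ring
    rw [← h2]
    exact_mod_cast h1
  have hbad2 := sum_negMulLog_le Bd w (fun q _ => hw0 q) _ hbadc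
  have hG1 : ∑ q ∈ G, w q ≤ 1 := sum_measureReal_dyadIco_le_one μ n G
  have hB1 : ∑ q ∈ Bd, w q ≤ η := by
    refine le_trans ?_ hn
    simp only [hw, dyadIco_eq_preimage]
    rw [sum_measureReal_preimage_singleton Bd
      (fun y _ => measurable_floor_mul n (measurableSet_singleton y))]
    refine measureReal_mono fun x hx => ?_
    have h1 : ⌊x * 2 ^ n⌋ ∈ Bd := hx
    exact (Finset.mem_filter.1 h1).2 (mem_dyadIco.2 rfl)
  have hn1 := negMulLog_le_one (Finset.sum_nonneg fun q (_ : q ∈ G) => hw0 q)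
  have hn2 := negMulLog_le_one (Finset.sum_nonneg fun q (_ : q ∈ Bd) => hw0 q)
  rw [Real.log_mul (by norm_num) (Real.exp_pos _).ne', Real.log_exp] at hgood
  rw [Real.log_mul (by positivity) (by positivity), Real.log_pow] at hbad2
  have hl3 : 0 ≤ Real.log 3 := Real.log_nonneg (by norm_num)
  have hlR : 0 ≤ Real.log R := Real.log_nonneg hR1
  have m1 := mul_le_mul_of_nonneg_right hG1
    (show 0 ≤ Real.log 3 + n * ((d + η) * Real.log 2) by positivity)
  have m2 := mul_le_mul_of_nonneg_right hB1
    (show 0 ≤ Real.log R + n * Real.log 2 by positivity)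
  have e : n * ((d + δ) * Real.log 2) = n * ((d + η) * Real.log 2) + η * (n * Real.log 2) +
      n * (2 * η * Real.log 2) := by
    rw [hη]; ring
  rw [hsplit, e]
  linarith

theorem exists_uniform_radius {μ : Measure ℝ} [IsFiniteMeasure μ] (hμ : ∀ x, μ {x} = 0)
    {K : Set ℝ} (hK : IsCompact K) {τ : ℝ} (hτ : 0 < τ) :
    ∃ r > 0, ∀ x ∈ K, μ.real (ball x r) ≤ τ := by
  have hloc : ∀ x : ℝ, ∃ r > 0, μ.real (ball x r) ≤ τ := by
    intro x
    have h1 : Tendsto (fun r : ℝ => μ (closedBall x r)) (𝓝[>] 0) (𝓝 (μ {x})) := by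
      have := tendsto_measure_biInter_gt (μ := μ) (s := fun r : ℝ => closedBall x r) (a := 0)
        (fun r _ => isClosed_closedBall.measurableSet.nullMeasurableSet)
        (fun i j _ hij => closedBall_subset_closedBall hij) ⟨1, one_pos, measure_ne_top _ _⟩
      have hx : ⋂ r > (0 : ℝ), closedBall x r = {x} := by
        ext y
        simp only [mem_singleton_iff, mem_iInter, mem_closedBall]
        refine ⟨fun h => ?_, fun h r hr => by simp [h, le_of_lt (show (0:ℝ) < r from hr)]⟩
        exact dist_le_zero.1 (le_of_forall_gt_imp_ge_of_dense fun r hr => h r hr)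
      rwa [hx] at this
    rw [hμ x] at h1
    have h2 := h1.eventually_lt_const (show (0 : ENNReal) < ENNReal.ofReal τ by simpa using hτ)
    obtain ⟨r, hr, hr0⟩ := (h2.and self_mem_nhdsWithin).exists
    refine ⟨r, hr0, ?_⟩
    refine (measureReal_mono ball_subset_closedBall).trans ?_
    exact ENNReal.toReal_le_of_le_ofReal hτ.le hr.le
  choose ρ hρ0 hρ using hloc
  obtain ⟨δ, hδ, h⟩ := lebesgue_number_lemma_of_metric (c := fun x => ball x (ρ x)) hK
    (fun x => isOpen_ball) (fun x _ => mem_iUnion.2 ⟨x, mem_ball_self (hρ0 x)⟩)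
  refine ⟨δ, hδ, fun x hx => ?_⟩
  obtain ⟨y, hy⟩ := h x hx
  exact (measureReal_mono hy).trans (hρ y)

/-! ### Bounded distortion -/

theorem compWord_append_singleton {Λ : Type*} (φ : Λ → ℝ → ℝ) (u : List Λ) (j : Λ) :
    compWord φ (u ++ [j]) = compWord φ u ∘ φ j := by
  induction u with
  | nil => rfl
  | cons i u ih => rw [List.cons_append, compWord, compWord, ih, Function.comp_assoc]

theorem abs_sub_bounds_of_deriv_bounds {F : ℝ → ℝ} (hc : ContinuousOn F unitI)
    (hd : ∀ x ∈ Ioo (0 : ℝ) 1, DifferentiableAt ℝ F x) {lo hi : ℝ}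
    (h : ∀ x ∈ Ioo (0 : ℝ) 1, lo ≤ |deriv F x| ∧ |deriv F x| ≤ hi) :
    ∀ x ∈ unitI, ∀ y ∈ unitI, lo * |x - y| ≤ |F x - F y| ∧ |F x - F y| ≤ hi * |x - y| := by
  have main : ∀ x ∈ unitI, ∀ y ∈ unitI, x < y →
      lo * |x - y| ≤ |F x - F y| ∧ |F x - F y| ≤ hi * |x - y| := by
    intro x hx y hy hxy
    obtain ⟨ξ, hξ, he⟩ := exists_deriv_eq_slope F hxy (hc.mono (Icc_subset_Icc hx.1 hy.2))
      (fun z hz => (hd z ⟨hx.1.trans_lt hz.1, hz.2.trans_le hy.2⟩).differentiableWithinAt)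
    have hb := h ξ ⟨hx.1.trans_lt hξ.1, hξ.2.trans_le hy.2⟩
    have hpos : 0 < y - x := sub_pos.2 hxy
    have h1 : |F x - F y| = |deriv F ξ| * |x - y| := by
      rw [he, abs_div, abs_sub_comm (F x), abs_sub_comm x,
        div_mul_cancel₀ _ (abs_pos.2 hpos.ne').ne']
    rw [h1]
    exact ⟨mul_le_mul_of_nonneg_right hb.1 (abs_nonneg _),
      mul_le_mul_of_nonneg_right hb.2 (abs_nonneg _)⟩
  intro x hx y hy
  rcases lt_trichotomy x y with h1 | h1 | h1
  · exact main x hx y hy h1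
  · simp [h1]
  · rw [abs_sub_comm x, abs_sub_comm (F x)]
    exact main y hy x hx h1

/-- The cylinder maps `compWord φ u` map the unit interval to itself and are bi-Lipschitz there
with constants comparable to a size `a u` that decays at most and at least geometrically. -/
structure HasBoundedDistortion {Λ : Type*} (φ : Λ → ℝ → ℝ) (a : List Λ → ℝ) (C c r : ℝ) :
    Prop where
  one_le : 1 ≤ C
  c_pos : 0 < c
  c_le_one : c ≤ 1
  r_pos : 0 < r
  r_lt_one : r < 1
  size_nil : a [] = 1
  size_pos : ∀ u, 0 < a u
  size_le : ∀ u, a u ≤ r ^ u.length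
  le_size_append : ∀ u j, c * a u ≤ a (u ++ [j])
  mapsTo : ∀ u, MapsTo (compWord φ u) unitI unitI
  lower : ∀ u, ∀ x ∈ unitI, ∀ y ∈ unitI,
    C⁻¹ * a u * |x - y| ≤ |compWord φ u x - compWord φ u y|
  upper : ∀ u, ∀ x ∈ unitI, ∀ y ∈ unitI,
    |compWord φ u x - compWord φ u y| ≤ C * a u * |x - y|

theorem exists_hasBoundedDistortion {Λ : Type*} [Finite Λ] [Nonempty Λ] (φ : Λ → ℝ → ℝ)
    (hanal : ∀ i, AnalyticOnNhd ℝ (φ i) unitI) (hmaps : ∀ i, MapsTo (φ i) unitI unitI)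
    (hderiv : ∀ i, ∀ x ∈ unitI, 0 < |deriv (φ i) x| ∧ |deriv (φ i) x| < 1) :
    ∃ a C c r, HasBoundedDistortion φ a C c r := by
  have hI : IsCompact unitI := isCompact_Icc
  have hne : unitI.Nonempty := ⟨0, by simp [unitI]⟩
  have h0 : (0 : ℝ) ∈ unitI := by simp [unitI]
  have hcont : ∀ i, ContinuousOn (fun x => |deriv (φ i) x|) unitI := fun i =>
    (hanal i).deriv.continuousOn.abs
  have hmax : ∀ i, ∃ R < 1, ∀ x ∈ unitI, |deriv (φ i) x| ≤ R := by
    intro i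
    obtain ⟨z, hz, hzm⟩ := hI.exists_isMaxOn hne (hcont i)
    exact ⟨_, (hderiv i z hz).2, fun x hx => hzm hx⟩
  have hmin : ∀ i, ∃ R > 0, ∀ x ∈ unitI, R ≤ |deriv (φ i) x| := by
    intro i
    obtain ⟨z, hz, hzm⟩ := hI.exists_isMinOn hne (hcont i)
    exact ⟨_, (hderiv i z hz).1, fun x hx => hzm hx⟩
  have hlip : ∀ i, ∃ R ≥ 0, ∀ x ∈ unitI, ∀ y ∈ unitI,
      |deriv (φ i) x - deriv (φ i) y| ≤ R * |x - y| := by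
    intro i
    obtain ⟨z, hz, hzm⟩ := hI.exists_isMaxOn hne ((hanal i).deriv.deriv.continuousOn.abs)
    refine ⟨|deriv (deriv (φ i)) z|, abs_nonneg _, fun x hx y hy => ?_⟩
    exact (abs_sub_bounds_of_deriv_bounds (lo := 0) (hanal i).deriv.continuousOn
      (fun x hx => ((hanal i).deriv x (Ioo_subset_Icc_self hx)).differentiableAt)
      (fun x hx => ⟨abs_nonneg _, hzm (Ioo_subset_Icc_self hx)⟩) x hx y hy).2
  choose R₁ hR₁ hR₁' using hmax
  choose R₂ hR₂ hR₂' using hmin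
  choose R₃ hR₃ hR₃' using hlip
  obtain ⟨i₁, hi₁⟩ := Finite.exists_max R₁
  obtain ⟨i₂, hi₂⟩ := Finite.exists_min R₂
  obtain ⟨i₃, hi₃⟩ := Finite.exists_max R₃
  set r := R₁ i₁
  set ρ := R₂ i₂
  set B := R₃ i₃
  have hr1 : r < 1 := hR₁ i₁
  have hρ : 0 < ρ := hR₂ i₂
  have hr : ∀ i, ∀ x ∈ unitI, |deriv (φ i) x| ≤ r := fun i x hx => (hR₁' i x hx).trans (hi₁ i)
  have hρ' : ∀ i, ∀ x ∈ unitI, ρ ≤ |deriv (φ i) x| := fun i x hx => (hi₂ i).trans (hR₂' i x hx)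
  have hr0 : 0 < r := hρ.trans_le ((hρ' i₁ 0 h0).trans (hr i₁ 0 h0))
  have hρr : ρ ≤ r := (hρ' i₁ 0 h0).trans (hr i₁ 0 h0)
  set A := B / ρ with hA
  have hA0 : 0 ≤ A := div_nonneg (hR₃ i₃) hρ.le
  have hdist : ∀ i, ∀ x ∈ unitI, ∀ y ∈ unitI,
      |deriv (φ i) x| ≤ Real.exp (A * |x - y|) * |deriv (φ i) y| := by
    intro i x hx y hy
    have h1 : |deriv (φ i) x| - |deriv (φ i) y| ≤ B * |x - y| :=
      (abs_sub_abs_le_abs_sub _ _).trans ((hR₃' i x hx y hy).trans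
        (mul_le_mul_of_nonneg_right (hi₃ i) (abs_nonneg _)))
    have h2 : B * |x - y| ≤ A * |x - y| * |deriv (φ i) y| := by
      have h3 : B * |x - y| = A * |x - y| * ρ := by rw [hA]; field_simp
      rw [h3]
      exact mul_le_mul_of_nonneg_left (hρ' i y hy) (mul_nonneg hA0 (abs_nonneg _))
    have h4 := mul_le_mul_of_nonneg_right (Real.add_one_le_exp (A * |x - y|))
      (abs_nonneg (deriv (φ i) y))
    linarith
  have hcontr : ∀ i, ∀ x ∈ unitI, ∀ y ∈ unitI, |φ i x - φ i y| ≤ r * |x - y| := fun i x hx y hy =>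
    (abs_sub_bounds_of_deriv_bounds (hanal i).continuousOn
      (fun x hx => (hanal i x (Ioo_subset_Icc_self hx)).differentiableAt)
      (fun x hx => ⟨abs_nonneg _, hr i x (Ioo_subset_Icc_self hx)⟩) x hx y hy).2
  set K := A / (1 - r) with hK
  have hK0 : 0 ≤ K := div_nonneg hA0 (by linarith)
  have hKr : K * r + A = K := by
    have : 1 - r ≠ 0 := by linarith
    rw [hK]; field_simp; ring
  have main : ∀ u : List Λ, MapsTo (compWord φ u) unitI unitI ∧
      (∀ x ∈ unitI, DifferentiableAt ℝ (compWord φ u) x) ∧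
      (∀ x ∈ unitI, 0 < |deriv (compWord φ u) x|) ∧
      (∀ x ∈ unitI, |deriv (compWord φ u) x| ≤ r ^ u.length) ∧
      ∀ x ∈ unitI, ∀ y ∈ unitI,
        |deriv (compWord φ u) x| ≤ Real.exp (K * |x - y|) * |deriv (compWord φ u) y| := by
    intro u
    induction u using List.reverseRecOn with
    | nil =>
      refine ⟨fun x hx => hx, fun x _ => differentiableAt_id, ?_, ?_, ?_⟩
      · intro x _; simp [compWord]
      · intro x _; simp [compWord]
      · intro x _ y _
        simpa [compWord] using mul_nonneg hK0 (abs_nonneg (x - y))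
    | append_singleton u j ih =>
      obtain ⟨ih1, ih2, ih3, ih4, ih5⟩ := ih
      rw [compWord_append_singleton]
      have hd : ∀ x ∈ unitI, deriv (compWord φ u ∘ φ j) x =
          deriv (compWord φ u) (φ j x) * deriv (φ j) x := fun x hx =>
        deriv_comp x (ih2 _ (hmaps j hx)) (hanal j x hx).differentiableAt
      refine ⟨ih1.comp (hmaps j), fun x hx =>
        (ih2 _ (hmaps j hx)).comp x (hanal j x hx).differentiableAt, ?_, ?_, ?_⟩
      · intro x hx
        rw [hd x hx, abs_mul]
        exact mul_pos (ih3 _ (hmaps j hx)) (hderiv j x hx).1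
      · intro x hx
        rw [hd x hx, abs_mul, List.length_append, List.length_singleton, pow_succ]
        exact mul_le_mul (ih4 _ (hmaps j hx)) (hr j x hx) (abs_nonneg _) (by positivity)
      · intro x hx y hy
        rw [hd x hx, hd y hy, abs_mul, abs_mul]
        have h1 := ih5 _ (hmaps j hx) _ (hmaps j hy)
        have h2 : Real.exp (K * |φ j x - φ j y|) ≤ Real.exp (K * r * |x - y|) := by
          rw [Real.exp_le_exp, mul_assoc]
          exact mul_le_mul_of_nonneg_left (hcontr j x hx y hy) hK0
        calc |deriv (compWord φ u) (φ j x)| * |deriv (φ j) x|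
            ≤ (Real.exp (K * r * |x - y|) * |deriv (compWord φ u) (φ j y)|) *
              (Real.exp (A * |x - y|) * |deriv (φ j) y|) := by
              refine mul_le_mul (h1.trans (mul_le_mul_of_nonneg_right h2 (abs_nonneg _)))
                (hdist j x hx y hy) (abs_nonneg _) (by positivity)
          _ = Real.exp (K * |x - y|) *
              (|deriv (compWord φ u) (φ j y)| * |deriv (φ j) y|) := by
              have e : Real.exp (K * |x - y|) =
                  Real.exp (K * r * |x - y|) * Real.exp (A * |x - y|) := by
                rw [← Real.exp_add, ← add_mul, hKr]
              rw [e]; ring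
  have hexp : ∀ u, ∀ x ∈ unitI, ∀ y ∈ unitI,
      |deriv (compWord φ u) x| ≤ Real.exp K * |deriv (compWord φ u) y| := by
    intro u x hx y hy
    refine ((main u).2.2.2.2 x hx y hy).trans (mul_le_mul_of_nonneg_right ?_ (abs_nonneg _))
    rw [Real.exp_le_exp]
    have : |x - y| ≤ 1 := by
      rw [abs_le]; constructor <;> linarith [hx.1, hx.2, hy.1, hy.2]
    exact mul_le_of_le_one_right hK0 this
  have hbil : ∀ u, ∀ x ∈ unitI, ∀ y ∈ unitI,
      (Real.exp K)⁻¹ * |deriv (compWord φ u) 0| * |x - y| ≤ |compWord φ u x - compWord φ u y| ∧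
      |compWord φ u x - compWord φ u y| ≤ Real.exp K * |deriv (compWord φ u) 0| * |x - y| := by
    intro u
    refine abs_sub_bounds_of_deriv_bounds
      (fun x hx => ((main u).2.1 x hx).continuousAt.continuousWithinAt)
      (fun x hx => (main u).2.1 x (Ioo_subset_Icc_self hx)) fun x hx => ⟨?_, ?_⟩
    · rw [inv_mul_le_iff₀ (Real.exp_pos _)]
      exact hexp u 0 h0 x (Ioo_subset_Icc_self hx)
    · exact hexp u x (Ioo_subset_Icc_self hx) 0 h0
  refine ⟨fun u => |deriv (compWord φ u) 0|, Real.exp K, (Real.exp K)⁻¹ * ρ, r, ?_⟩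
  refine ⟨Real.one_le_exp hK0, by positivity, ?_, hr0, hr1, by simp [compWord],
    fun u => (main u).2.2.1 0 h0, fun u => (main u).2.2.2.1 0 h0, ?_, fun u => (main u).1,
    fun u x hx y hy => (hbil u x hx y hy).1, fun u x hx y hy => (hbil u x hx y hy).2⟩
  · exact mul_le_one₀ (inv_le_one_of_one_le₀ (Real.one_le_exp hK0)) hρ.le (by linarith)
  · intro u j
    rw [compWord_append_singleton, deriv_comp 0 ((main u).2.1 _ (hmaps j h0))
      (hanal j 0 h0).differentiableAt, abs_mul]
    have h1 : (Real.exp K)⁻¹ * |deriv (compWord φ u) 0| ≤ |deriv (compWord φ u) (φ j 0)| := by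
      rw [inv_mul_le_iff₀ (Real.exp_pos _)]
      exact hexp u 0 h0 _ (hmaps j h0)
    calc (Real.exp K)⁻¹ * ρ * |deriv (compWord φ u) 0|
        = ((Real.exp K)⁻¹ * |deriv (compWord φ u) 0|) * ρ := by ring
      _ ≤ _ := mul_le_mul h1 (hρ' j 0 h0) hρ.le (abs_nonneg _)

theorem compWord_eqOn {Λ : Type*} {φ φ' : Λ → ℝ → ℝ} {s : Set ℝ} (h : ∀ i, EqOn (φ i) (φ' i) s)
    (hmaps : ∀ i, MapsTo (φ i) s s) (u : List Λ) : EqOn (compWord φ u) (compWord φ' u) s := by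
  induction u using List.reverseRecOn with
  | nil => exact fun x _ => rfl
  | append_singleton u j ih =>
    intro x hx
    rw [compWord_append_singleton, compWord_append_singleton, Function.comp, Function.comp,
      ih (hmaps j hx), h j hx]

theorem measurable_compWord {Λ : Type*} {φ : Λ → ℝ → ℝ} (h : ∀ i, Measurable (φ i)) (u : List Λ) :
    Measurable (compWord φ u) := by
  induction u with
  | nil => exact measurable_id
  | cons i u ih => exact (h i).comp ih

theorem HasBoundedDistortion.congr {Λ : Type*} {φ φ' : Λ → ℝ → ℝ} {a : List Λ → ℝ} {C c r : ℝ}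
    (h : HasBoundedDistortion φ a C c r) (he : ∀ i, EqOn (φ i) (φ' i) unitI)
    (hmaps : ∀ i, MapsTo (φ i) unitI unitI) : HasBoundedDistortion φ' a C c r := by
  have e := fun u => compWord_eqOn he hmaps u
  refine { h with mapsTo := ?_, lower := ?_, upper := ?_ }
  · exact fun u => (h.mapsTo u).congr (e u)
  · intro u x hx y hy
    rw [← e u hx, ← e u hy]
    exact h.lower u x hx y hy
  · intro u x hx y hy
    rw [← e u hx, ← e u hy]
    exact h.upper u x hx y hy

theorem measurable_indicator_of_continuousOn {f : ℝ → ℝ} {s : Set ℝ} (hs : IsClosed s)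
    (hf : ContinuousOn f s) : Measurable (s.indicator f) := by
  classical
  rw [← piecewise_eq_indicator]
  exact hf.measurable_piecewise continuousOn_const hs.measurableSet

/-- Induction over words up to the cylinders of size comparable to `s`. -/
theorem HasBoundedDistortion.cylinder_induction {Λ : Type*} {φ : Λ → ℝ → ℝ} {a : List Λ → ℝ}
    {C c r : ℝ} (h : HasBoundedDistortion φ a C c r) (Q : List Λ → Prop) {s : ℝ} (hs : 0 < s)
    (hs1 : s ≤ 1) (base : ∀ u, c * s ≤ a u → a u ≤ s → Q u)
    (step : ∀ u, (∀ j, Q (u ++ [j])) → Q u) : Q [] := by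
  obtain ⟨n₀, hn₀⟩ := exists_pow_lt_of_lt_one hs h.r_lt_one
  have key : ∀ t : ℕ, ∀ u : List Λ, n₀ ≤ u.length + t → c * s ≤ a u → Q u := by
    intro t
    induction t with
    | zero =>
      intro u hu hcu
      exact base u hcu ((h.size_le u).trans
        ((pow_le_pow_of_le_one h.r_pos.le h.r_lt_one.le hu).trans hn₀.le))
    | succ t ih =>
      intro u hu hcu
      rcases le_or_gt (a u) s with hle | hgt
      · exact base u hcu hle
      · refine step u fun j => ih _ (by simp; omega) ?_
        exact (mul_le_mul_of_nonneg_left hgt.le h.c_pos.le).trans (h.le_size_append u j)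
  refine key n₀ [] (by simp) ?_
  rw [h.size_nil]
  exact mul_le_one₀ h.c_le_one hs.le hs1

/-! ### Lower bounds for entropies of components -/

theorem measureReal_map_append {Λ : Type*} [Fintype Λ] {φ : Λ → ℝ → ℝ}
    (hφ : ∀ i, Measurable (φ i)) {p : Λ → ℝ} (hp : ∀ i, 0 ≤ p i) {μ : Measure ℝ}
    [IsProbabilityMeasure μ] (hμ : μ = ∑ i, ENNReal.ofReal (p i) • μ.map (φ i))
    {ψ : ℝ → ℝ} (hψ : Measurable ψ) (u : List Λ) (A : Set ℝ) :
    (μ.map (ψ ∘ compWord φ u)).real A =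
      ∑ j, p j * (μ.map (ψ ∘ compWord φ (u ++ [j]))).real A := by
  have hg : Measurable (ψ ∘ compWord φ u) := hψ.comp (measurable_compWord hφ u)
  have h1 : μ.map (ψ ∘ compWord φ u) =
      ∑ j, ENNReal.ofReal (p j) • μ.map (ψ ∘ compWord φ (u ++ [j])) := by
    conv_lhs => rw [hμ]
    rw [Measure.map_finset_sum hg.aemeasurable]
    refine Finset.sum_congr rfl fun j _ => ?_
    rw [Measure.map_smul, Measure.map_map hg (hφ j), compWord_append_singleton]
    rfl
  rw [h1, Measure.real, Measure.finsetSum_apply, ENNReal.toReal_sum]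
  · refine Finset.sum_congr rfl fun j _ => ?_
    rw [Measure.smul_apply, smul_eq_mul, ENNReal.toReal_mul, ENNReal.toReal_ofReal (hp j)]
    rfl
  · intro j _
    rw [Measure.smul_apply, smul_eq_mul]
    have : IsProbabilityMeasure (μ.map (ψ ∘ compWord φ (u ++ [j]))) :=
      Measure.isProbabilityMeasure_map (hψ.comp (measurable_compWord hφ _)).aemeasurable
    exact ENNReal.mul_ne_top ENNReal.ofReal_ne_top (measure_ne_top _ _)

theorem HasBoundedDistortion.comp_bounds {Λ : Type*} {φ : Λ → ℝ → ℝ} {a : List Λ → ℝ}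
    {C c r : ℝ} (h : HasBoundedDistortion φ a C c r) {ε : ℝ} (hε : 0 < ε) {ψ : ℝ → ℝ}
    (hψ : ∀ x ∈ unitI, ∀ y ∈ unitI, ε * |x - y| ≤ |ψ x - ψ y| ∧ |ψ x - ψ y| ≤ ε⁻¹ * |x - y|)
    (u : List Λ) : ∀ x ∈ unitI, ∀ y ∈ unitI,
      (C / ε)⁻¹ * a u * |x - y| ≤ |(ψ ∘ compWord φ u) x - (ψ ∘ compWord φ u) y| ∧
      |(ψ ∘ compWord φ u) x - (ψ ∘ compWord φ u) y| ≤ (C / ε) * a u * |x - y| := by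
  intro x hx y hy
  obtain ⟨h1, h2⟩ := hψ _ (h.mapsTo u hx) _ (h.mapsTo u hy)
  have h3 := mul_le_mul_of_nonneg_left (h.lower u x hx y hy) hε.le
  have h4 := mul_le_mul_of_nonneg_left (h.upper u x hx y hy) (inv_pos.2 hε).le
  constructor
  · refine le_trans (le_of_eq ?_) (h3.trans h1)
    rw [inv_div]; ring
  · refine (h2.trans h4).trans (le_of_eq ?_)
    ring

theorem exists_measure_gridNhd_le {Λ : Type*} [Fintype Λ] {φ : Λ → ℝ → ℝ}
    (hφ : ∀ i, Measurable (φ i)) {p : Λ → ℝ} (hp : ∀ i, 0 ≤ p i) (hp1 : ∑ i, p i = 1)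
    {μ : Measure ℝ} [IsProbabilityMeasure μ] (hI : ∀ᵐ x ∂μ, x ∈ unitI)
    (hμ : μ = ∑ i, ENNReal.ofReal (p i) • μ.map (φ i))
    {a : List Λ → ℝ} {C c r : ℝ} (h : HasBoundedDistortion φ a C c r)
    (hatom : ∀ x, μ {x} = 0) {ε : ℝ} (hε : 0 < ε) (hε1 : ε < 1) {τ : ℝ} (hτ : 0 < τ) :
    ∃ k : ℕ, ∀ ψ : ℝ → ℝ, Measurable ψ →
      (∀ x ∈ unitI, ∀ y ∈ unitI, ε * |x - y| ≤ |ψ x - ψ y| ∧ |ψ x - ψ y| ≤ ε⁻¹ * |x - y|) →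
      ∀ i, (μ.map ψ).real (gridNhd i k) ≤ τ := by
  set M := C / ε with hM
  have hM1 : 1 ≤ M := by
    rw [hM, le_div_iff₀ hε]; linarith [h.one_le]
  have hM0 : 0 < M := by linarith
  have hc := h.c_pos
  obtain ⟨ρ, hρ, hρμ⟩ := exists_uniform_radius hatom (isCompact_Icc (a := (0 : ℝ)) (b := 1))
    (show 0 < τ / 7 by positivity)
  obtain ⟨k, hk⟩ := exists_pow_lt_of_lt_one (show 0 < ρ * c / (2 * M ^ 2) by positivity)
    (show (1 / 2 : ℝ) < 1 by norm_num)
  refine ⟨k, fun ψ hψm hψ i => ?_⟩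
  have h2i : (0 : ℝ) < 2 ^ i := by positivity
  have h2k : (1 : ℝ) ≤ 2 ^ k := one_le_pow₀ (by norm_num)
  have hQ : (fun u : List Λ => (μ.map (ψ ∘ compWord φ u)).real (gridNhd i k) ≤ τ) [] := by
    refine h.cylinder_induction (fun u => (μ.map (ψ ∘ compWord φ u)).real (gridNhd i k) ≤ τ)
      (s := (2 ^ i)⁻¹ / M) (by positivity) ?_ ?_ ?_
    · rw [div_le_one hM0]
      exact (inv_le_one_of_one_le₀ (one_le_pow₀ (by norm_num))).trans hM1
    · intro u hlo hhi
      have hbd := h.comp_bounds hε hψ u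
      set g := ψ ∘ compWord φ u with hg
      have hgm : Measurable g := hψm.comp (measurable_compWord hφ u)
      rw [map_measureReal_apply hgm (measurableSet_gridNhd i k)]
      have hau := h.size_pos u
      have hsmall : ∀ x ∈ unitI, ∀ y ∈ unitI, |g x - g y| ≤ (2 ^ i)⁻¹ := by
        intro x hx y hy
        refine (hbd x hx y hy).2.trans ?_
        have : |x - y| ≤ 1 := by
          rw [abs_le]; constructor <;> linarith [hx.1, hx.2, hy.1, hy.2]
        have h3 : M * a u ≤ (2 ^ i)⁻¹ := by rwa [le_div_iff₀' hM0] at hhi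
        exact (mul_le_of_le_one_right (by positivity) this).trans h3
      have hpiece : ∀ z : ℤ, μ.real (g ⁻¹' closedBall ((z : ℝ) / 2 ^ i) (2 ^ (i + k))⁻¹) ≤
          τ / 7 := by
        intro z
        by_cases hex : ∃ x ∈ unitI, x ∈ g ⁻¹' closedBall ((z : ℝ) / 2 ^ i) (2 ^ (i + k))⁻¹
        · obtain ⟨x, hx, hxg⟩ := hex
          refine le_trans ?_ (hρμ x hx)
          refine ENNReal.toReal_mono (measure_ne_top _ _) (measure_mono_ae ?_)
          filter_upwards [hI] with y hy hyg
          change y ∈ ball x ρ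
          change g y ∈ closedBall _ _ at hyg
          change g x ∈ closedBall _ _ at hxg
          rw [mem_closedBall, Real.dist_eq] at hxg hyg
          have h3 : |g y - g x| ≤ 2 * (2 ^ (i + k))⁻¹ := by
            rw [abs_le] at hxg hyg ⊢
            constructor <;> linarith [hxg.1, hxg.2, hyg.1, hyg.2]
          have h4 := (hbd y hy x hx).1.trans h3
          rw [mem_ball, Real.dist_eq]
          have h5 : M⁻¹ * (c * ((2 ^ i)⁻¹ / M)) * |y - x| ≤ 2 * (2 ^ (i + k))⁻¹ := by
            refine le_trans ?_ h4
            gcongr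
          have h6 : |y - x| * (c / M ^ 2) ≤ 2 * (1 / 2) ^ k := by
            have e1 : M⁻¹ * (c * ((2 ^ i)⁻¹ / M)) * |y - x| = (|y - x| * (c / M ^ 2)) / 2 ^ i := by
              field_simp
            have e2 : (2 : ℝ) * (2 ^ (i + k))⁻¹ = (2 * (1 / 2) ^ k) / 2 ^ i := by
              rw [pow_add, one_div, inv_pow]; field_simp
            rw [e1, e2] at h5
            exact (div_le_div_iff_of_pos_right h2i).1 h5
          have h7 : 2 * (1 / 2 : ℝ) ^ k < ρ * (c / M ^ 2) := by
            have : ρ * (c / M ^ 2) = 2 * (ρ * c / (2 * M ^ 2)) := by field_simp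
            rw [this]
            linarith
          exact lt_of_mul_lt_mul_right (h6.trans_lt h7) (by positivity)
        · push Not at hex
          have : μ (g ⁻¹' closedBall ((z : ℝ) / 2 ^ i) (2 ^ (i + k))⁻¹) = 0 := by
            rw [measure_eq_zero_iff_ae_notMem]
            filter_upwards [hI] with x hx
            exact hex x hx
          rw [Measure.real, this]
          simp
          positivity
      have hpow : ((2 : ℝ) ^ (i + k))⁻¹ ≤ (2 ^ i)⁻¹ := by
        rw [pow_add]
        exact inv_anti₀ h2i (le_mul_of_one_le_right h2i.le h2k)
      by_cases hex : ∃ x ∈ unitI, g x ∈ gridNhd i k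
      · obtain ⟨x, hx, hxg⟩ := hex
        obtain ⟨z₀, hz₀⟩ := mem_iUnion.1 hxg
        rw [mem_closedBall, Real.dist_eq] at hz₀
        have hcover : μ.real (g ⁻¹' gridNhd i k) ≤
            μ.real (⋃ z ∈ Finset.Icc (z₀ - 3) (z₀ + 3),
              g ⁻¹' closedBall ((z : ℝ) / 2 ^ i) (2 ^ (i + k))⁻¹) := by
          refine ENNReal.toReal_mono (measure_ne_top _ _) (measure_mono_ae ?_)
          filter_upwards [hI] with y hy hyg
          obtain ⟨z, hz⟩ := mem_iUnion.1 (show g y ∈ gridNhd i k from hyg)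
          refine mem_iUnion₂.2 ⟨z, ?_, hz⟩
          rw [mem_closedBall, Real.dist_eq] at hz
          have h3 : |(z : ℝ) / 2 ^ i - z₀ / 2 ^ i| ≤ 3 * (2 ^ i)⁻¹ := by
            have h4 := hsmall y hy x hx
            rw [abs_le] at hz hz₀ h4 ⊢
            constructor <;> linarith [hz.1, hz.2, hz₀.1, hz₀.2, h4.1, h4.2]
          rw [← sub_div, abs_div, abs_of_pos h2i, ← div_eq_mul_inv,
            div_le_div_iff_of_pos_right h2i, abs_le] at h3
          have h5 : -3 ≤ z - z₀ := by exact_mod_cast h3.1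
          have h6 : z - z₀ ≤ 3 := by exact_mod_cast h3.2
          rw [Finset.mem_Icc]
          omega
        refine hcover.trans ((measureReal_biUnion_finset_le _ _).trans ?_)
        refine (Finset.sum_le_sum fun z _ => hpiece z).trans ?_
        rw [Finset.sum_const, Int.card_Icc, show (z₀ + 3 + 1 - (z₀ - 3)).toNat = 7 by omega,
          nsmul_eq_mul]
        apply le_of_eq
        push_cast
        ring
      · push Not at hex
        have : μ (g ⁻¹' gridNhd i k) = 0 := by
          rw [measure_eq_zero_iff_ae_notMem]
          filter_upwards [hI] with x hx
          exact hex x hx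
        rw [Measure.real, this]
        simpa using hτ.le
    · intro u hu
      rw [measureReal_map_append hφ hp hμ hψm u]
      calc _ ≤ ∑ j, p j * τ := Finset.sum_le_sum fun j _ => mul_le_mul_of_nonneg_left (hu j) (hp j)
        _ = τ := by rw [← Finset.sum_mul, hp1, one_mul]
  exact hQ

theorem mem_gridNhd_of_mem_of_notMem {i k : ℕ} {q : ℤ} {x y : ℝ} (hx : x ∈ dyadIco i q)
    (hy : y ∉ dyadIco i q) (hxy : |x - y| ≤ (2 ^ (i + k))⁻¹) : x ∈ gridNhd i k := by
  rw [dyadIco, mem_Ico] at hx hy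
  rw [abs_le] at hxy
  rw [gridNhd, mem_iUnion]
  by_cases h : (q : ℝ) / 2 ^ i ≤ y
  · refine ⟨q + 1, ?_⟩
    rw [mem_closedBall, Real.dist_eq, abs_le]
    push_cast
    have : ((q : ℝ) + 1) / 2 ^ i ≤ y := by
      by_contra hcon
      exact hy ⟨h, not_le.1 hcon⟩
    constructor <;> linarith [hx.1, hx.2]
  · refine ⟨q, ?_⟩
    rw [mem_closedBall, Real.dist_eq, abs_le]
    push Not at h
    constructor <;> linarith [hx.1, hx.2]

theorem exists_condEnt_ge {Λ : Type*} [Fintype Λ] {φ : Λ → ℝ → ℝ}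
    (hφ : ∀ i, Measurable (φ i)) {p : Λ → ℝ} (hp : ∀ i, 0 ≤ p i)
    {μ : Measure ℝ} [IsProbabilityMeasure μ] (hI : ∀ᵐ x ∂μ, x ∈ unitI)
    (hμ : μ = ∑ i, ENNReal.ofReal (p i) • μ.map (φ i))
    {a : List Λ → ℝ} {C c r : ℝ} (h : HasBoundedDistortion φ a C c r)
    {lam δ : ℝ} (hlam : 0 ≤ lam) (hδ : 0 < δ)
    (hent : ∀ᶠ l : ℕ in atTop, l * (lam + δ) ≤ cellEnt 0 2 l μ)
    {ε : ℝ} (hε : 0 < ε) (hε1 : ε < 1) (k : ℕ) :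
    ∀ᶠ l : ℕ in atTop, ∀ ψ : ℝ → ℝ, Measurable ψ →
      (∀ x ∈ unitI, ∀ y ∈ unitI, ε * |x - y| ≤ |ψ x - ψ y| ∧ |ψ x - ψ y| ≤ ε⁻¹ * |x - y|) →
      ∀ i q, l * lam * ((μ.map ψ).real (dyadIco i q) -
        (μ.map ψ).real (gridNhd i k ∩ dyadIco i q)) ≤ condEnt i l q (μ.map ψ) := by
  set M := C / ε with hM
  have hM1 : 1 ≤ M := by
    rw [hM, le_div_iff₀ hε]; linarith [h.one_le]
  have hM0 : 0 < M := by linarith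
  have hc := h.c_pos
  obtain ⟨N, hN⟩ := exists_nat_ge (2 ^ k * M ^ 2 / c + 1)
  have hlarge : ∀ᶠ l : ℕ in atTop, Real.log (2 * N + 1) ≤ l * δ :=
    (tendsto_natCast_atTop_atTop.atTop_mul_const hδ).eventually_ge_atTop _
  filter_upwards [hent, hlarge] with l hl hlN ψ hψm hψ i q
  have h2l : (0 : ℝ) < 2 ^ l := by positivity
  have hprob : ∀ u : List Λ, IsProbabilityMeasure (μ.map (ψ ∘ compWord φ u)) := fun u =>
    Measure.isProbabilityMeasure_map (hψm.comp (measurable_compWord hφ _)).aemeasurable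
  have hQ : (fun u : List Λ => l * lam * ((μ.map (ψ ∘ compWord φ u)).real (dyadIco i q) -
        (μ.map (ψ ∘ compWord φ u)).real (gridNhd i k ∩ dyadIco i q)) ≤
          condEnt i l q (μ.map (ψ ∘ compWord φ u))) [] := by
    refine h.cylinder_induction (fun u => l * lam * ((μ.map (ψ ∘ compWord φ u)).real (dyadIco i q) -
        (μ.map (ψ ∘ compWord φ u)).real (gridNhd i k ∩ dyadIco i q)) ≤
          condEnt i l q (μ.map (ψ ∘ compWord φ u)))
      (s := (2 ^ (i + k))⁻¹ / M) (by positivity) ?_ ?_ ?_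
    · rw [div_le_one hM0]
      exact (inv_le_one_of_one_le₀ (one_le_pow₀ (by norm_num))).trans hM1
    · intro u hlo hhi
      have hbd := h.comp_bounds hε hψ u
      have hpu := hprob u
      set g := ψ ∘ compWord φ u with hg
      have hgm : Measurable g := hψm.comp (measurable_compWord hφ u)
      have hau := h.size_pos u
      have hll : 0 ≤ l * lam := mul_nonneg (Nat.cast_nonneg _) hlam
      by_cases hall : ∀ x ∈ unitI, g x ∈ dyadIco i q
      · have hfull : (μ.map g).real (dyadIco i q) = 1 := by
          rw [map_measureReal_apply hgm (measurableSet_dyadIco i q), Measure.real,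
            (mem_ae_iff_prob_eq_one (hgm (measurableSet_dyadIco i q))).1, ENNReal.toReal_one]
          filter_upwards [hI] with x hx
          exact hall x hx
        have hS : ∀ᵐ x ∂μ, ⌊g x * 2 ^ (i + l)⌋ ∈ Finset.Ico (q * 2 ^ l) ((q + 1) * 2 ^ l) := by
          filter_upwards [hI] with x hx
          exact (floor_mul_mem_Ico_iff i l q (g x)).2 (mem_dyadIco.1 (hall x hx))
        have hT : ∀ᵐ x ∂μ, ⌊x * 2 ^ l⌋ ∈ Finset.Ico ((0 : ℤ) * 2 ^ l) (2 * 2 ^ l) := by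
          filter_upwards [hI] with x hx
          refine floor_mul_mem_Ico ⟨?_, ?_⟩ l
          · simpa using hx.1
          · have := hx.2
            push_cast
            linarith
        have hlab := label_entropy_le μ unitI hI ((measurable_floor_mul (i + l)).comp hgm)
          (measurable_floor_mul l) _ _ hS hT N (by
            intro x hx y hy hxy
            have h1 : |g x * 2 ^ (i + l) - g y * 2 ^ (i + l)| < 1 :=
              Int.abs_sub_lt_one_of_floor_eq_floor hxy
            rw [← sub_mul, abs_mul, abs_of_pos (show (0 : ℝ) < 2 ^ (i + l) by positivity)] at h1
            have h2 : M⁻¹ * (c * ((2 ^ (i + k))⁻¹ / M)) * |x - y| ≤ |g x - g y| := by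
              refine le_trans ?_ (hbd x hx y hy).1
              gcongr
            have h3 := (mul_le_mul_of_nonneg_right h2
              (show (0 : ℝ) ≤ 2 ^ (i + l) by positivity)).trans h1.le
            have e1 : M⁻¹ * (c * ((2 ^ (i + k))⁻¹ / M)) * |x - y| * 2 ^ (i + l) =
                (|x - y| * 2 ^ l) / (2 ^ k * M ^ 2 / c) := by
              rw [pow_add, pow_add]; field_simp
            rw [e1, div_le_one (by positivity)] at h3
            have h4 : |x * 2 ^ l - y * 2 ^ l| ≤ 2 ^ k * M ^ 2 / c := by
              rwa [← sub_mul, abs_mul, abs_of_pos h2l]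
            have h5 : (|⌊x * 2 ^ l⌋ - ⌊y * 2 ^ l⌋| : ℝ) ≤ N + 1 - 1 + 0 := by
              rw [abs_le] at h4 ⊢
              have f1 := Int.floor_le (x * 2 ^ l)
              have f2 := Int.lt_floor_add_one (x * 2 ^ l)
              have f3 := Int.floor_le (y * 2 ^ l)
              have f4 := Int.lt_floor_add_one (y * 2 ^ l)
              constructor <;> linarith [h4.1, h4.2]
            have h6 : (|⌊x * 2 ^ l⌋ - ⌊y * 2 ^ l⌋| : ℝ) ≤ N := by linarith
            exact_mod_cast h6)
        have hcond : condEnt i l q (μ.map g) =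
            ∑ m ∈ Finset.Ico (q * 2 ^ l) ((q + 1) * 2 ^ l), Real.negMulLog
              (μ.real (((fun x : ℝ => ⌊x * 2 ^ (i + l)⌋) ∘ g) ⁻¹' {m})) := by
          rw [condEnt, hfull, Real.negMulLog_one, sub_zero]
          refine Finset.sum_congr rfl fun m _ => ?_
          rw [map_measureReal_apply hgm (measurableSet_dyadIco _ _), dyadIco_eq_preimage]
          rfl
        have hcell : cellEnt 0 2 l μ = ∑ j ∈ Finset.Ico ((0 : ℤ) * 2 ^ l) (2 * 2 ^ l),
            Real.negMulLog (μ.real ((fun x : ℝ => ⌊x * 2 ^ l⌋) ⁻¹' {j})) := by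
          simp only [cellEnt, dyadIco_eq_preimage]
        rw [← hcond, ← hcell] at hlab
        rw [hfull]
        have h7 : l * lam * (1 - (μ.map g).real (gridNhd i k ∩ dyadIco i q)) ≤ l * lam :=
          mul_le_of_le_one_right hll (sub_le_self _ measureReal_nonneg)
        linarith
      · push Not at hall
        obtain ⟨y, hy, hyq⟩ := hall
        refine le_trans ?_ (condEnt_nonneg i l q _)
        refine mul_nonpos_of_nonneg_of_nonpos hll (sub_nonpos.2 ?_)
        rw [map_measureReal_apply hgm (measurableSet_dyadIco i q), map_measureReal_apply hgm
          ((measurableSet_gridNhd i k).inter (measurableSet_dyadIco i q))]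
        refine ENNReal.toReal_mono (measure_ne_top _ _) (measure_mono_ae ?_)
        filter_upwards [hI] with x hx hxq
        refine ⟨mem_gridNhd_of_mem_of_notMem hxq hyq ?_, hxq⟩
        refine (hbd x hx y hy).2.trans ?_
        have : |x - y| ≤ 1 := by
          rw [abs_le]; constructor <;> linarith [hx.1, hx.2, hy.1, hy.2]
        have h3 : M * a u ≤ (2 ^ (i + k))⁻¹ := by rwa [le_div_iff₀' hM0] at hhi
        exact (mul_le_of_le_one_right (by positivity) this).trans h3
    · intro u hu
      have hpu := hprob u
      have hpj := fun j => hprob (u ++ [j])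
      refine le_trans ?_ (condEnt_superadditive p hp _ (fun j => μ.map (ψ ∘ compWord φ (u ++ [j])))
        (fun A _ => measureReal_map_append hφ hp hμ hψm u A) i l q)
      rw [measureReal_map_append hφ hp hμ hψm u (dyadIco i q),
        measureReal_map_append hφ hp hμ hψm u (gridNhd i k ∩ dyadIco i q),
        ← Finset.sum_sub_distrib, Finset.mul_sum]
      refine Finset.sum_le_sum fun j _ => ?_
      have := mul_le_mul_of_nonneg_left (hu j) (hp j)
      linarith
  exact hQ

/-! ### Entropy of components of components -/

theorem mem_dcell {n : ℕ} {x y : ℝ} : y ∈ dcell n x ↔ ⌊y * 2 ^ n⌋ = ⌊x * 2 ^ n⌋ := mem_dyadIco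

theorem measurableSet_dcell (n : ℕ) (x : ℝ) : MeasurableSet (dcell n x) :=
  measurableSet_dyadIco _ _

theorem dcell_subset {i j : ℕ} (hij : i ≤ j) {x y : ℝ} (hy : y ∈ dcell i x) :
    dcell j y ⊆ dcell i x := by
  obtain ⟨l, rfl⟩ := Nat.exists_eq_add_of_le hij
  intro z hz
  rw [mem_dcell] at hz hy ⊢
  rwa [← floor_mul_mem_Ico_iff i l, hz, floor_mul_mem_Ico_iff i l]

theorem measureReal_dcomp (θ : Measure ℝ) (x : ℝ) (i : ℕ) (A : Set ℝ) :
    (dcomp θ x i).real A = θ.real (A ∩ dcell i x) / θ.real (dcell i x) := by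
  rw [dcomp, Measure.real, Measure.smul_apply, smul_eq_mul,
    Measure.restrict_apply' (measurableSet_dcell i x), ENNReal.toReal_mul, ENNReal.toReal_inv,
    mul_comm, ← div_eq_mul_inv]
  rfl

theorem dcomp_dcomp (θ : Measure ℝ) [IsFiniteMeasure θ] {i j : ℕ} (hij : i ≤ j) {x y : ℝ}
    (hy : y ∈ dcell i x) (h0 : θ (dcell i x) ≠ 0) :
    dcomp (dcomp θ x i) y j = dcomp θ y j := by
  have hsub := dcell_subset hij hy
  have htop : θ (dcell i x) ≠ ⊤ := measure_ne_top _ _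
  rw [dcomp, dcomp, Measure.smul_apply, Measure.restrict_smul,
    Measure.restrict_restrict (measurableSet_dcell j y),
    Measure.restrict_apply (measurableSet_dcell j y), inter_eq_left.2 hsub, smul_smul, smul_eq_mul,
    ENNReal.mul_inv (Or.inl (ENNReal.inv_ne_zero.2 htop)) (Or.inl (ENNReal.inv_ne_top.2 h0)),
    inv_inv, mul_right_comm, ENNReal.mul_inv_cancel h0 htop, one_mul, dcomp]

theorem ent1_eq_tsum (n : ℕ) (ν : Measure ℝ) :
    ent1 n ν = (∑' m : ℤ, Real.negMulLog (ν.real (dyadIco n m))) / Real.log 2 := by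
  rw [ent1, ← tsum_neg, ← tsum_div_const]
  refine tsum_congr fun m => ?_
  rw [Real.negMulLog, Real.logb, Measure.real]
  ring

theorem sum_negMulLog_div {ι : Type*} (S : Finset ι) (a : ι → ℝ) {D : ℝ} (hD : D ≠ 0)
    (ha : D = ∑ m ∈ S, a m) :
    ∑ m ∈ S, Real.negMulLog (a m / D) =
      (∑ m ∈ S, Real.negMulLog (a m) - Real.negMulLog D) / D := by
  have h : ∀ m ∈ S, Real.negMulLog (a m / D) =
      Real.negMulLog (a m) / D + a m * (Real.log D / D) := by
    intro m _
    by_cases hm : a m = 0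
    · simp [hm]
    · rw [Real.negMulLog, Real.negMulLog, Real.log_div hm hD]
      ring
  rw [Finset.sum_congr rfl h, Finset.sum_add_distrib, ← Finset.sum_div, ← Finset.sum_mul, ← ha,
    Real.negMulLog]
  ring

theorem ent1_dcomp (θ : Measure ℝ) [IsFiniteMeasure θ] (i l : ℕ) {x : ℝ}
    (h0 : θ (dcell i x) ≠ 0) :
    ent1 (i + l) (dcomp θ x i) =
      condEnt i l ⌊x * 2 ^ i⌋ θ / (θ.real (dcell i x) * Real.log 2) := by
  have hD : θ.real (dcell i x) ≠ 0 := (measureReal_ne_zero_iff).2 h0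
  have hchild : ∀ m ∈ Finset.Ico (⌊x * 2 ^ i⌋ * 2 ^ l) ((⌊x * 2 ^ i⌋ + 1) * 2 ^ l),
      dyadIco (i + l) m ∩ dcell i x = dyadIco (i + l) m := by
    intro m hm
    refine inter_eq_left.2 fun z hz => ?_
    rw [mem_dyadIco] at hz
    rw [mem_dcell, ← floor_mul_mem_Ico_iff i l, hz]
    exact hm
  rw [ent1_eq_tsum, tsum_eq_sum (s := Finset.Ico (⌊x * 2 ^ i⌋ * 2 ^ l)
    ((⌊x * 2 ^ i⌋ + 1) * 2 ^ l)), ← div_div]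
  · congr 1
    rw [Finset.sum_congr rfl fun m hm => by rw [measureReal_dcomp, hchild m hm],
      sum_negMulLog_div _ _ hD (measureReal_dyadIco_eq_sum θ i l _)]
    rfl
  · intro m hm
    have : dyadIco (i + l) m ∩ dcell i x = ∅ := by
      rw [← disjoint_iff_inter_eq_empty, disjoint_left]
      intro z hz hzx
      rw [mem_dyadIco] at hz
      rw [mem_dcell, ← floor_mul_mem_Ico_iff i l, hz] at hzx
      exact hm hzx
    rw [measureReal_dcomp, this]
    simp

/-- The points whose level-`j` component has normalized level-`(j + l)` entropy at distance at
least `ε` from `d`. -/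
def badSet (θ : Measure ℝ) (j l : ℕ) (d ε : ℝ) : Set ℝ :=
  {y | ε ≤ |(1 / (l : ℝ)) * ent1 (j + l) (dcomp θ y j) - d|}

/-- The mean deviation from `d` of the normalized entropies of the level-`j` components. -/
def meanDev (A B : ℤ) (j l : ℕ) (d : ℝ) (θ : Measure ℝ) : ℝ :=
  ∑ q ∈ Finset.Ico (A * 2 ^ j) (B * 2 ^ j),
    |condEnt j l q θ / (l * Real.log 2) - d * θ.real (dyadIco j q)|

theorem measureReal_eq_sum_inter_dyadIco (θ : Measure ℝ) [IsFiniteMeasure θ] {A B : ℤ}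
    (hAB : ∀ᵐ x ∂θ, x ∈ Ico (A : ℝ) B) (j : ℕ) (s : Set ℝ) :
    θ.real s = ∑ q ∈ Finset.Ico (A * 2 ^ j) (B * 2 ^ j), θ.real (s ∩ dyadIco j q) := by
  simp only [dyadIco_eq_preimage]
  refine measureReal_eq_sum_fiber θ (measurable_floor_mul j) _ ?_ s
  filter_upwards [hAB] with x hx using floor_mul_mem_Ico hx j

theorem dcell_eq_dyadIco {j : ℕ} {q : ℤ} {x : ℝ} (hx : x ∈ dyadIco j q) :
    dcell j x = dyadIco j q := by
  rw [dcell, mem_dyadIco.1 hx]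

theorem measureReal_badSet_le (θ : Measure ℝ) [IsFiniteMeasure θ] {A B : ℤ}
    (hAB : ∀ᵐ x ∂θ, x ∈ Ico (A : ℝ) B) (j l : ℕ) (d : ℝ) {ε : ℝ} (hε : 0 < ε) :
    θ.real (badSet θ j l d ε) ≤ ε⁻¹ * meanDev A B j l d θ := by
  rw [measureReal_eq_sum_inter_dyadIco θ hAB j, meanDev, Finset.mul_sum]
  refine Finset.sum_le_sum fun q _ => ?_
  by_cases h0 : θ (badSet θ j l d ε ∩ dyadIco j q) = 0
  · rw [Measure.real, h0]
    simp only [ENNReal.toReal_zero]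
    positivity
  · obtain ⟨y, hyb, hyq⟩ := nonempty_of_measure_ne_zero h0
    have hq0 : θ (dyadIco j q) ≠ 0 := fun h => h0 (measure_mono_null inter_subset_right h)
    have hqr : 0 < θ.real (dyadIco j q) :=
      lt_of_le_of_ne measureReal_nonneg ((measureReal_ne_zero_iff).2 hq0).symm
    rw [← dcell_eq_dyadIco hyq] at hq0
    have h1 : ε ≤ |(1 / (l : ℝ)) * ent1 (j + l) (dcomp θ y j) - d| := hyb
    rw [ent1_dcomp θ j l hq0, dcell_eq_dyadIco hyq, mem_dyadIco.1 hyq] at h1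
    refine (measureReal_mono inter_subset_right).trans ?_
    rw [← div_eq_inv_mul, le_div_iff₀ hε]
    calc θ.real (dyadIco j q) * ε ≤ θ.real (dyadIco j q) * _ :=
          mul_le_mul_of_nonneg_left h1 hqr.le
      _ = _ := by
        rw [← abs_of_pos hqr, ← abs_mul, abs_of_pos hqr, mul_sub]
        congr 2
        · field_simp
        · ring

theorem one_sub_le_measure_component (θ : Measure ℝ) [IsFiniteMeasure θ] {i j : ℕ} (hij : i ≤ j)
    (l : ℕ) (d ε : ℝ) {x : ℝ} (h0 : θ (dcell i x) ≠ 0) :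
    1 - θ.real (badSet θ j l d ε ∩ dcell i x) / θ.real (dcell i x) ≤
      ((dcomp θ x i) {y | |(1 / (l : ℝ)) * ent1 (j + l) (dcomp (dcomp θ x i) y j) - d| < ε}).toReal
    := by
  have hD : 0 < θ.real (dcell i x) :=
    lt_of_le_of_ne measureReal_nonneg ((measureReal_ne_zero_iff).2 h0).symm
  change _ ≤ (dcomp θ x i).real _
  rw [measureReal_dcomp, sub_le_iff_le_add, ← add_div, one_le_div hD]
  refine le_trans ?_ (measureReal_union_le _ _)
  refine ENNReal.toReal_mono (measure_ne_top _ _) (measure_mono_ae ?_)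
  filter_upwards with y hy
  by_cases hb : y ∈ badSet θ j l d ε
  · exact Or.inr ⟨hb, hy⟩
  · refine Or.inl ⟨?_, hy⟩
    rw [mem_ofPred_eq, dcomp_dcomp θ hij hy h0]
    exact not_le.1 hb

/-- The points whose level-`i` component has a proportion larger than `1 - ε` of components
between the levels `i` and `i + m` with normalized entropy `ε`-close to `d`. -/
def goodSet (θ : Measure ℝ) (i l m : ℕ) (d ε : ℝ) : Set ℝ :=
  {x | 1 - ε < ((m : ℝ) + 1)⁻¹ * ∑ j ∈ Finset.Icc i (i + m),
    ((dcomp θ x i)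
      {y | |(1 / (l : ℝ)) * ent1 (j + l) (dcomp (dcomp θ x i) y j) - d| < ε}).toReal}

theorem measureReal_compl_goodSet_le (θ : Measure ℝ) [IsFiniteMeasure θ] {A B : ℤ}
    (hAB : ∀ᵐ x ∂θ, x ∈ Ico (A : ℝ) B) (i l m : ℕ) (d : ℝ) {ε : ℝ} (hε : 0 < ε) :
    θ.real (goodSet θ i l m d ε)ᶜ ≤
      (ε * (m + 1))⁻¹ * ∑ j ∈ Finset.Icc i (i + m), θ.real (badSet θ j l d ε) := by
  have hm : (0 : ℝ) < m + 1 := by positivity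
  rw [measureReal_eq_sum_inter_dyadIco θ hAB i, Finset.sum_congr rfl fun j _ =>
    measureReal_eq_sum_inter_dyadIco θ hAB i (badSet θ j l d ε), Finset.sum_comm, Finset.mul_sum]
  refine Finset.sum_le_sum fun q _ => ?_
  by_cases h0 : θ ((goodSet θ i l m d ε)ᶜ ∩ dyadIco i q) = 0
  · rw [Measure.real, h0]
    simp only [ENNReal.toReal_zero]
    positivity
  · obtain ⟨x, hx, hxq⟩ := nonempty_of_measure_ne_zero h0
    have hq0 : θ (dyadIco i q) ≠ 0 := fun h => h0 (measure_mono_null inter_subset_right h)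
    rw [← dcell_eq_dyadIco hxq] at hq0 ⊢
    have hD : 0 < θ.real (dcell i x) :=
      lt_of_le_of_ne measureReal_nonneg ((measureReal_ne_zero_iff).2 hq0).symm
    rw [mem_compl_iff, goodSet, mem_ofPred_eq, not_lt] at hx
    have h1 : ∑ j ∈ Finset.Icc i (i + m),
        (1 - θ.real (badSet θ j l d ε ∩ dcell i x) / θ.real (dcell i x)) ≤ (m + 1) * (1 - ε) := by
      rw [← inv_mul_le_iff₀ hm]
      refine le_trans (mul_le_mul_of_nonneg_left ?_ (inv_pos.2 hm).le) hx
      exact Finset.sum_le_sum fun j hj =>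
        one_sub_le_measure_component θ (Finset.mem_Icc.1 hj).1 l d ε hq0
    rw [Finset.sum_sub_distrib, Finset.sum_const, Nat.card_Icc,
      show i + m + 1 - i = m + 1 by omega, nsmul_eq_mul, mul_one, ← Finset.sum_div] at h1
    push_cast at h1
    have h2 : ε * (m + 1) ≤ (∑ j ∈ Finset.Icc i (i + m),
        θ.real (badSet θ j l d ε ∩ dcell i x)) / θ.real (dcell i x) := by linarith
    rw [le_div_iff₀ hD] at h2
    refine (measureReal_mono inter_subset_right).trans ?_
    rwa [le_inv_mul_iff₀ (by positivity)]

theorem sum_sum_Icc_add_le (f : ℕ → ℝ) (hf : ∀ j, 0 ≤ f j) (m n : ℕ) :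
    ∑ i ∈ Finset.Icc 1 n, ∑ j ∈ Finset.Icc i (i + m), f j ≤
      (m + 1) * ∑ j ∈ Finset.Icc 1 (n + m), f j := by
  have h1 : ∀ i, ∑ j ∈ Finset.Icc i (i + m), f j = ∑ t ∈ Finset.range (m + 1), f (i + t) := by
    intro i
    rw [← Finset.Ico_succ_right_eq_Icc, Finset.sum_Ico_eq_sum_range]
    congr 2
    simp
    omega
  simp only [h1]
  rw [Finset.sum_comm]
  calc _ ≤ ∑ t ∈ Finset.range (m + 1), ∑ j ∈ Finset.Icc 1 (n + m), f j := by
        refine Finset.sum_le_sum fun t ht => ?_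
        rw [← Finset.sum_image (s := Finset.Icc 1 n) (g := fun i => i + t) (f := f)
          (fun a _ b _ h => by simpa using h)]
        refine Finset.sum_le_sum_of_subset_of_nonneg ?_ fun j _ _ => hf j
        intro j hj
        obtain ⟨i, hi, rfl⟩ := Finset.mem_image.1 hj
        rw [Finset.mem_Icc] at hi ⊢
        rw [Finset.mem_range] at ht
        omega
    _ = _ := by
        rw [Finset.sum_const, Finset.card_range, nsmul_eq_mul]
        push_cast
        rfl

theorem one_sub_lt_average_goodSet (θ : Measure ℝ) [IsProbabilityMeasure θ] {A B : ℤ}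
    (hAB : ∀ᵐ x ∂θ, x ∈ Ico (A : ℝ) B) {l m n : ℕ} (hmn : m ≤ n) (hn : 1 ≤ n) {d ε : ℝ}
    (hε : 0 < ε)
    (h : ∑ j ∈ Finset.Icc 1 (n + m), meanDev A B j l d θ ≤ (n + m : ℕ) * (ε ^ 3 / 4)) :
    1 - ε < (1 / (n : ℝ)) * ∑ i ∈ Finset.Icc 1 n, (θ (goodSet θ i l m d ε)).toReal := by
  have hn0 : (0 : ℝ) < n := by exact_mod_cast hn
  have hm : (0 : ℝ) < m + 1 := by positivity
  have hmn' : (m : ℝ) ≤ n := by exact_mod_cast hmn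
  have h1 : ∀ i, 1 - θ.real (goodSet θ i l m d ε)ᶜ ≤ (θ (goodSet θ i l m d ε)).toReal := by
    intro i
    have := measureReal_union_le (μ := θ) (goodSet θ i l m d ε) (goodSet θ i l m d ε)ᶜ
    rw [union_compl_self, probReal_univ] at this
    change _ ≤ θ.real _
    linarith
  have h2 : ∑ i ∈ Finset.Icc 1 n, θ.real (goodSet θ i l m d ε)ᶜ ≤ n * (ε / 2) := by
    calc _ ≤ ∑ i ∈ Finset.Icc 1 n, (ε * (m + 1))⁻¹ *
            ∑ j ∈ Finset.Icc i (i + m), θ.real (badSet θ j l d ε) :=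
          Finset.sum_le_sum fun i _ => measureReal_compl_goodSet_le θ hAB i l m d hε
      _ = (ε * (m + 1))⁻¹ * ∑ i ∈ Finset.Icc 1 n,
            ∑ j ∈ Finset.Icc i (i + m), θ.real (badSet θ j l d ε) := by rw [Finset.mul_sum]
      _ ≤ (ε * (m + 1))⁻¹ * ((m + 1) * ∑ j ∈ Finset.Icc 1 (n + m), θ.real (badSet θ j l d ε)) := by
          gcongr
          exact sum_sum_Icc_add_le _ (fun _ => measureReal_nonneg) m n
      _ ≤ (ε * (m + 1))⁻¹ * ((m + 1) * ∑ j ∈ Finset.Icc 1 (n + m), ε⁻¹ * meanDev A B j l d θ) := by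
          gcongr
          exact measureReal_badSet_le θ hAB _ l d hε
      _ = (ε ^ 2)⁻¹ * ∑ j ∈ Finset.Icc 1 (n + m), meanDev A B j l d θ := by
          rw [← Finset.mul_sum]
          field_simp
      _ ≤ (ε ^ 2)⁻¹ * ((n + m : ℕ) * (ε ^ 3 / 4)) := by gcongr
      _ = (n + m) * (ε / 4) := by
          push_cast
          field_simp
      _ ≤ n * (ε / 2) := by nlinarith
  have h3 := Finset.sum_le_sum fun i (_ : i ∈ Finset.Icc 1 n) => h1 i
  rw [Finset.sum_sub_distrib, Finset.sum_const, Nat.card_Icc, Nat.add_sub_cancel, nsmul_eq_mul,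
    mul_one] at h3
  rw [one_div, ← div_eq_inv_mul, lt_div_iff₀ hn0]
  nlinarith

/-! ### Mean deviation of the entropies of components -/

theorem meanDev_le (θ : Measure ℝ) [IsProbabilityMeasure θ] {A B : ℤ}
    (hAB : ∀ᵐ x ∂θ, x ∈ Ico (A : ℝ) B) (j l : ℕ) {d η τ : ℝ} (hη : 0 ≤ η) (hd : 0 ≤ d) (s : Set ℝ)
    (hs : d * θ.real s ≤ τ)
    (h : ∀ q, d * θ.real (dyadIco j q) - condEnt j l q θ / (l * Real.log 2) ≤
      η * θ.real (dyadIco j q) + d * θ.real (s ∩ dyadIco j q)) :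
    meanDev A B j l d θ ≤
      (cellEnt A B (j + l) θ - cellEnt A B j θ) / (l * Real.log 2) - d + 2 * (η + τ) := by
  have h1 : ∀ q, |condEnt j l q θ / (l * Real.log 2) - d * θ.real (dyadIco j q)| ≤
      condEnt j l q θ / (l * Real.log 2) - d * θ.real (dyadIco j q) +
        2 * (η * θ.real (dyadIco j q) + d * θ.real (s ∩ dyadIco j q)) := by
    intro q
    have h2 : 0 ≤ η * θ.real (dyadIco j q) + d * θ.real (s ∩ dyadIco j q) := by positivity
    have h3 := h q
    rw [abs_le]
    constructor <;> linarith
  refine (Finset.sum_le_sum fun q _ => h1 q).trans ?_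
  have e1 := measureReal_eq_sum_inter_dyadIco θ hAB j univ
  simp only [univ_inter, probReal_univ] at e1
  have e2 := measureReal_eq_sum_inter_dyadIco θ hAB j s
  rw [Finset.sum_add_distrib, Finset.sum_sub_distrib, ← Finset.sum_div, sum_condEnt,
    ← Finset.mul_sum, ← Finset.mul_sum, Finset.sum_add_distrib, ← Finset.mul_sum,
    ← Finset.mul_sum, ← e1, ← e2]
  linarith

theorem eventually_meanDev_le {Λ : Type*} [Fintype Λ] {φ : Λ → ℝ → ℝ}
    (hφ : ∀ i, Measurable (φ i)) {p : Λ → ℝ} (hp : ∀ i, 0 ≤ p i) (hp1 : ∑ i, p i = 1)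
    {μ : Measure ℝ} [IsProbabilityMeasure μ] (hI : ∀ᵐ x ∂μ, x ∈ unitI)
    (hI2 : ∀ᵐ x ∂μ, x ∈ Ico ((0 : ℤ) : ℝ) (2 : ℤ))
    (hμ : μ = ∑ i, ENNReal.ofReal (p i) • μ.map (φ i))
    {a : List Λ → ℝ} {C c r : ℝ} (h : HasBoundedDistortion φ a C c r)
    {d : ℝ} (hdim : ExactDimWith μ d) {ε : ℝ} (hε : 0 < ε) (hε1 : ε < 1) {η : ℝ} (hη : 0 < η) :
    ∀ᶠ l : ℕ in atTop, ∀ ψ : ℝ → ℝ, Measurable ψ →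
      (∀ x ∈ unitI, ∀ y ∈ unitI, ε * |x - y| ≤ |ψ x - ψ y| ∧ |ψ x - ψ y| ≤ ε⁻¹ * |x - y|) →
      ∀ A B : ℤ, (∀ᵐ x ∂(μ.map ψ), x ∈ Ico (A : ℝ) B) → ∀ j,
      meanDev A B j l d (μ.map ψ) ≤
        (cellEnt A B (j + l) (μ.map ψ) - cellEnt A B j (μ.map ψ)) / (l * Real.log 2) - d +
          4 * η := by
  have hlog : 0 < Real.log 2 := Real.log_pos (by norm_num)
  have hd := hdim.nonneg
  rcases le_or_gt d η with hdη | hdη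
  · refine Eventually.of_forall fun l ψ hψm _ A B hAB j => ?_
    have hprob : IsProbabilityMeasure (μ.map ψ) :=
      Measure.isProbabilityMeasure_map hψm.aemeasurable
    refine (meanDev_le (μ.map ψ) hAB j l hη.le hd ∅ (τ := 0) (by simp) fun q => ?_).trans
      (by linarith)
    have h1 : 0 ≤ condEnt j l q (μ.map ψ) / (l * Real.log 2) :=
      div_nonneg (condEnt_nonneg _ _ _ _) (by positivity)
    have h2 := mul_le_mul_of_nonneg_right hdη
      (measureReal_nonneg (μ := μ.map ψ) (s := dyadIco j q))
    simp only [empty_inter, measureReal_empty]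
    linarith
  · have hd0 : 0 < d := hη.trans hdη
    obtain ⟨k, hk⟩ := exists_measure_gridNhd_le hφ hp hp1 hI hμ h
      (hdim.measure_singleton hd0) hε hε1 (show 0 < η / d by positivity)
    have hent : ∀ᶠ l : ℕ in atTop,
        l * ((d - η) * Real.log 2 + η / 2 * Real.log 2) ≤ cellEnt 0 2 l μ := by
      filter_upwards [hdim.le_cellEnt hI2 (show 0 < η / 2 by positivity)] with l hl
      refine le_trans (le_of_eq ?_) hl
      ring
    filter_upwards [eventually_gt_atTop 0, exists_condEnt_ge hφ hp hI hμ h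
      (mul_nonneg (sub_nonneg.2 hdη.le) hlog.le) (show 0 < η / 2 * Real.log 2 by positivity)
      hent hε hε1 k] with l hl0 hl ψ hψm hψ A B hAB j
    have hl0' : (0 : ℝ) < l := by exact_mod_cast hl0
    have hprob : IsProbabilityMeasure (μ.map ψ) :=
      Measure.isProbabilityMeasure_map hψm.aemeasurable
    have hτ : d * (μ.map ψ).real (gridNhd j k) ≤ η := by
      have := mul_le_mul_of_nonneg_left (hk ψ hψm hψ j) hd
      rwa [mul_div_cancel₀ _ hd0.ne'] at this
    refine (meanDev_le (μ.map ψ) hAB j l hη.le hd (gridNhd j k) hτ fun q => ?_).trans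
      (by linarith)
    have h1 : (d - η) * ((μ.map ψ).real (dyadIco j q) -
        (μ.map ψ).real (gridNhd j k ∩ dyadIco j q)) ≤
          condEnt j l q (μ.map ψ) / (l * Real.log 2) := by
      rw [le_div_iff₀ (by positivity)]
      refine le_trans (le_of_eq ?_) (hl ψ hψm hψ j q)
      ring
    have h2 : 0 ≤ η * (μ.map ψ).real (gridNhd j k ∩ dyadIco j q) := by positivity
    linarith

theorem cellEnt_map_le {μ : Measure ℝ} [IsProbabilityMeasure μ] (hI : ∀ᵐ x ∂μ, x ∈ unitI)
    (hI2 : ∀ᵐ x ∂μ, x ∈ Ico ((0 : ℤ) : ℝ) (2 : ℤ)) {M : ℝ} {N : ℕ} (hN : M + 1 ≤ N)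
    (hM : 0 ≤ M) {ψ : ℝ → ℝ} (hψm : Measurable ψ)
    (hψ : ∀ x ∈ unitI, ∀ y ∈ unitI, |ψ x - ψ y| ≤ M * |x - y|) {A B : ℤ}
    (hAB : ∀ᵐ x ∂(μ.map ψ), x ∈ Ico (A : ℝ) B) (n : ℕ) :
    cellEnt A B n (μ.map ψ) ≤ cellEnt 0 2 n μ + Real.log (2 * N + 1) := by
  have h2 : (0 : ℝ) < 2 ^ n := by positivity
  have hlab := label_entropy_le μ unitI hI (measurable_floor_mul n)
    ((measurable_floor_mul n).comp hψm) (Finset.Ico ((0 : ℤ) * 2 ^ n) (2 * 2 ^ n))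
    (Finset.Ico (A * 2 ^ n) (B * 2 ^ n))
    (by filter_upwards [hI2] with x hx using floor_mul_mem_Ico hx n)
    (by filter_upwards [ae_of_ae_map hψm.aemeasurable hAB] with x hx using floor_mul_mem_Ico hx n)
    N (by
      intro x hx y hy hxy
      have h1 : |x * 2 ^ n - y * 2 ^ n| < 1 := Int.abs_sub_lt_one_of_floor_eq_floor hxy
      rw [← sub_mul, abs_mul, abs_of_pos h2] at h1
      have h3 : |ψ x * 2 ^ n - ψ y * 2 ^ n| ≤ M := by
        rw [← sub_mul, abs_mul, abs_of_pos h2]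
        calc |ψ x - ψ y| * 2 ^ n ≤ M * |x - y| * 2 ^ n :=
              mul_le_mul_of_nonneg_right (hψ x hx y hy) h2.le
          _ = M * (|x - y| * 2 ^ n) := by ring
          _ ≤ M := mul_le_of_le_one_right hM h1.le
      have h5 : (|⌊ψ x * 2 ^ n⌋ - ⌊ψ y * 2 ^ n⌋| : ℝ) ≤ N := by
        rw [abs_le] at h3 ⊢
        have f1 := Int.floor_le (ψ x * 2 ^ n)
        have f2 := Int.lt_floor_add_one (ψ x * 2 ^ n)
        have f3 := Int.floor_le (ψ y * 2 ^ n)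
        have f4 := Int.lt_floor_add_one (ψ y * 2 ^ n)
        constructor <;> linarith [h3.1, h3.2]
      exact_mod_cast h5)
  have e1 : cellEnt A B n (μ.map ψ) = ∑ j ∈ Finset.Ico (A * 2 ^ n) (B * 2 ^ n),
      Real.negMulLog (μ.real (((fun x : ℝ => ⌊x * 2 ^ n⌋) ∘ ψ) ⁻¹' {j})) := by
    refine Finset.sum_congr rfl fun q _ => ?_
    rw [map_measureReal_apply hψm (measurableSet_dyadIco n q), dyadIco_eq_preimage]
    rfl
  have e2 : cellEnt 0 2 n μ = ∑ j ∈ Finset.Ico ((0 : ℤ) * 2 ^ n) (2 * 2 ^ n),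
      Real.negMulLog (μ.real ((fun x : ℝ => ⌊x * 2 ^ n⌋) ⁻¹' {j})) := by
    simp only [cellEnt, dyadIco_eq_preimage]
  rw [e1, e2]
  exact hlab

theorem eventually_sum_meanDev_le {Λ : Type*} [Fintype Λ] {φ : Λ → ℝ → ℝ}
    (hφ : ∀ i, Measurable (φ i)) {p : Λ → ℝ} (hp : ∀ i, 0 ≤ p i) (hp1 : ∑ i, p i = 1)
    {μ : Measure ℝ} [IsProbabilityMeasure μ] (hI : ∀ᵐ x ∂μ, x ∈ unitI)
    (hμ : μ = ∑ i, ENNReal.ofReal (p i) • μ.map (φ i))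
    {a : List Λ → ℝ} {C c r : ℝ} (h : HasBoundedDistortion φ a C c r)
    {d : ℝ} (hdim : ExactDimWith μ d) {ε : ℝ} (hε : 0 < ε) (hε1 : ε < 1) {κ : ℝ} (hκ : 0 < κ) :
    ∀ᶠ l : ℕ in atTop, ∀ᶠ n : ℕ in atTop, ∀ ψ : ℝ → ℝ, Measurable ψ →
      (∀ x ∈ unitI, ∀ y ∈ unitI, ε * |x - y| ≤ |ψ x - ψ y| ∧ |ψ x - ψ y| ≤ ε⁻¹ * |x - y|) →
      ∀ A B : ℤ, (∀ᵐ x ∂(μ.map ψ), x ∈ Ico (A : ℝ) B) →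
      ∑ j ∈ Finset.Icc 1 n, meanDev A B j l d (μ.map ψ) ≤ n * κ := by
  have hlog : 0 < Real.log 2 := Real.log_pos (by norm_num)
  have hI2 : ∀ᵐ x ∂μ, x ∈ Ico ((0 : ℤ) : ℝ) (2 : ℤ) := by
    filter_upwards [hI] with x hx
    have h1 := hx.1
    have h2 := hx.2
    rw [mem_Ico]
    push_cast
    constructor <;> linarith
  obtain ⟨N, hN⟩ := exists_nat_ge (ε⁻¹ + 1)
  set η := κ / 10 with hη
  have hη0 : 0 < η := by positivity
  filter_upwards [eventually_gt_atTop 0,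
    eventually_meanDev_le hφ hp hp1 hI hI2 hμ h hdim hε hε1 hη0] with l hl0 hl
  have hl0' : (0 : ℝ) < l := by exact_mod_cast hl0
  have hshift : ∀ᶠ n : ℕ in atTop, cellEnt 0 2 (n + l) μ ≤
      ((n + l : ℕ) : ℝ) * ((d + η) * Real.log 2) :=
    (tendsto_add_atTop_nat l).eventually (hdim.cellEnt_le hI2 hη0)
  have hlarge : ∀ᶠ n : ℕ in atTop,
      l * (d + η) + Real.log (2 * N + 1) / Real.log 2 ≤ n * (5 * η) :=
    (tendsto_natCast_atTop_atTop.atTop_mul_const (by positivity)).eventually_ge_atTop _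
  filter_upwards [hshift, hlarge] with n hn1 hn2 ψ hψm hψ A B hAB
  have hprob : IsProbabilityMeasure (μ.map ψ) :=
    Measure.isProbabilityMeasure_map hψm.aemeasurable
  have h1 := cellEnt_map_le hI hI2 hN (inv_pos.2 hε).le hψm
    (fun x hx y hy => (hψ x hx y hy).2) hAB (n + l)
  have h2 := sum_sub_shift_le (fun n => cellEnt A B n (μ.map ψ)) (cellEnt_mono A B _)
    (fun n => cellEnt_nonneg A B n _) l n
  have h3 : (∑ j ∈ Finset.Icc 1 n, (cellEnt A B (j + l) (μ.map ψ) - cellEnt A B j (μ.map ψ))) /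
      (l * Real.log 2) ≤ (n + l) * (d + η) + Real.log (2 * N + 1) / Real.log 2 := by
    rw [div_le_iff₀ (by positivity)]
    refine h2.trans ((mul_le_mul_of_nonneg_left (h1.trans (add_le_add_left hn1 _))
      hl0'.le).trans (le_of_eq ?_))
    push_cast
    field_simp
  refine (Finset.sum_le_sum fun j _ => hl ψ hψm hψ A B hAB j).trans ?_
  rw [Finset.sum_add_distrib, Finset.sum_sub_distrib, ← Finset.sum_div, Finset.sum_const,
    Finset.sum_const, Nat.card_Icc, Nat.add_sub_cancel, nsmul_eq_mul, nsmul_eq_mul]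
  have e : κ = 10 * η := by rw [hη]; ring
  rw [e]
  linarith

theorem uniform_entropy_dimension_components_of_components
    {Λ : Type} [Fintype Λ] [Nonempty Λ]
    (φ : Λ → ℝ → ℝ)
    (hanal : ∀ i, AnalyticOnNhd ℝ (φ i) unitI)
    (hmaps : ∀ i, Set.MapsTo (φ i) unitI unitI)
    (hderiv : ∀ i, ∀ x ∈ unitI, 0 < |deriv (φ i) x| ∧ |deriv (φ i) x| < 1)
    (hnofix : ¬ ∃ x ∈ unitI, ∀ i, φ i x = x)
    (p : Λ → ℝ) (hp : ∀ i, 0 < p i) (hp1 : ∑ i, p i = 1)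
    (μ : Measure ℝ) (hprob : IsProbabilityMeasure μ) (hμI : μ unitIᶜ = 0)
    (hμ : μ = ∑ i : Λ, ENNReal.ofReal (p i) • Measure.map (φ i) μ)
    (dμ : ℝ) (hdim : ExactDimWith μ dμ) :
    ∀ ε : ℝ, 0 < ε → ε < 1 → ∀ m : ℕ, 1 ≤ m →
      ∃ L : ℕ, 1 ≤ L ∧ ∀ l : ℕ, L ≤ l →
        ∃ N : ℕ, 1 ≤ N ∧ ∀ n : ℕ, N ≤ n →
          ∀ ψ : ℝ → ℝ, ContDiffOn ℝ 1 ψ unitI →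
            (∀ x ∈ unitI, ε ≤ |derivWithin ψ unitI x| ∧ |derivWithin ψ unitI x| ≤ ε⁻¹) →
            1 - ε < (1 / (n : ℝ)) * ∑ i ∈ Finset.Icc 1 n,
              ((μ.map ψ) {x | 1 - ε < ((m : ℝ) + 1)⁻¹ * ∑ j ∈ Finset.Icc i (i + m),
                ((dcomp (μ.map ψ) x i)
                  {y | |(1 / (l : ℝ)) * ent1 (j + l) (dcomp (dcomp (μ.map ψ) x i) y j) - dμ| < ε}).toReal}).toReal := by
  intro ε hε hε1 m hm
  have hI : ∀ᵐ x ∂μ, x ∈ unitI := by rwa [ae_iff]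
  have hclosed : IsClosed unitI := isClosed_Icc
  obtain ⟨a, C, c, r, hbd⟩ := exists_hasBoundedDistortion φ hanal hmaps hderiv
  have heq : ∀ f : ℝ → ℝ, EqOn f (unitI.indicator f) unitI := fun f x hx =>
    (indicator_of_mem hx f).symm
  have hmap : ∀ f : ℝ → ℝ, μ.map f = μ.map (unitI.indicator f) := fun f =>
    Measure.map_congr (by filter_upwards [hI] with x hx using heq f hx)
  have hφm : ∀ i, Measurable (unitI.indicator (φ i)) := fun i =>
    measurable_indicator_of_continuousOn hclosed (hanal i).continuousOn
  have hμ' : μ = ∑ i, ENNReal.ofReal (p i) • μ.map (unitI.indicator (φ i)) := by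
    simpa only [← hmap] using hμ
  obtain ⟨L₀, hL₀⟩ := eventually_atTop.1 (eventually_sum_meanDev_le hφm (fun i => (hp i).le) hp1 hI
    hμ' (hbd.congr (fun i => heq (φ i)) hmaps) hdim hε hε1 (show 0 < ε ^ 3 / 4 by positivity))
  refine ⟨max L₀ 1, le_max_right _ _, fun l hl => ?_⟩
  obtain ⟨N₀, hN₀⟩ := eventually_atTop.1 (hL₀ l ((le_max_left _ _).trans hl))
  refine ⟨max (max N₀ m) 1, le_max_right _ _, fun n hn ψ hψ hψd => ?_⟩
  have hnN : N₀ ≤ n := (le_max_left _ _).trans ((le_max_left _ _).trans hn)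
  have hnm : m ≤ n := (le_max_right _ _).trans ((le_max_left _ _).trans hn)
  have hn1 : 1 ≤ n := (le_max_right _ _).trans hn
  have hψm : Measurable (unitI.indicator ψ) :=
    measurable_indicator_of_continuousOn hclosed hψ.continuousOn
  have hnhds : ∀ x ∈ Ioo (0 : ℝ) 1, unitI ∈ 𝓝 x := fun x hx => Icc_mem_nhds hx.1 hx.2
  have hψb := abs_sub_bounds_of_deriv_bounds hψ.continuousOn
    (fun x hx => (hψ.differentiableOn one_ne_zero).differentiableAt (hnhds x hx))
    (fun x hx => by
      rw [← derivWithin_of_mem_nhds (hnhds x hx)]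
      exact hψd x (Ioo_subset_Icc_self hx))
  have hψb' : ∀ x ∈ unitI, ∀ y ∈ unitI,
      ε * |x - y| ≤ |unitI.indicator ψ x - unitI.indicator ψ y| ∧
        |unitI.indicator ψ x - unitI.indicator ψ y| ≤ ε⁻¹ * |x - y| := by
    intro x hx y hy
    rw [← heq ψ hx, ← heq ψ hy]
    exact hψb x hx y hy
  have hprob' : IsProbabilityMeasure (μ.map (unitI.indicator ψ)) :=
    Measure.isProbabilityMeasure_map hψm.aemeasurable
  have hAB : ∀ᵐ x ∂(μ.map (unitI.indicator ψ)),
      x ∈ Ico ((⌊ψ 0 - ε⁻¹⌋ : ℤ) : ℝ) ((⌊ψ 0 + ε⁻¹⌋ + 1 : ℤ) : ℝ) := by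
    refine (ae_map_iff (p := fun x => x ∈ Ico ((⌊ψ 0 - ε⁻¹⌋ : ℤ) : ℝ) ((⌊ψ 0 + ε⁻¹⌋ + 1 : ℤ) : ℝ))
      hψm.aemeasurable measurableSet_Ico).2 ?_
    filter_upwards [hI] with x hx
    rw [← heq ψ hx]
    have h0 : (0 : ℝ) ∈ unitI := ⟨le_rfl, zero_le_one⟩
    have h1 : |ψ x - ψ 0| ≤ ε⁻¹ := by
      refine (hψb x hx 0 h0).2.trans (mul_le_of_le_one_right (inv_pos.2 hε).le ?_)
      rw [sub_zero, abs_of_nonneg hx.1]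
      exact hx.2
    rw [abs_le] at h1
    have h2 := Int.floor_le (ψ 0 - ε⁻¹)
    have h3 := Int.lt_floor_add_one (ψ 0 + ε⁻¹)
    push_cast
    constructor <;> linarith [h1.1, h1.2]
  rw [hmap ψ]
  exact one_sub_lt_average_goodSet _ hAB hnm hn1 hε
    (hN₀ (n + m) (hnN.trans (Nat.le_add_right n m)) _ hψm hψb' _ _ hAB)
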